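/- arXiv:2004.12101 — 6 statements merged into one kernel-verified Lean document; each statement's English description precedes it below -/
import Mathlib

section
/- Let E be the infinite-dimensional Grassmann algebra over a field K of characteristic zero, and let n ≥ 2. If B ∈ Mₙ(E₁) satisfies tr(Bᵗ) = 0 for all 1 ≤ t ≤ 2n−2, then n·B^{2n−1} = tr(B^{2n−1})·Iₙ is a scalar matrix; if moreover tr(B^{2n−1}) = 0, then B^{2n−1} = 0. -/
open Matrix

section NilAux

open Polynomial

theorem aux_derivative_det {R : Type*} [CommRing R] {n : ℕ} (M : Matrix (Fin n) (Fin n) R[X]) :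
    derivative M.det = (M.adjugate * M.map derivative).trace := by
  have h : ∀ i, (M.adjugate * M.map derivative) i i
      = (M.updateCol i (fun j => derivative (M j i))).det := by
    intro i
    rw [← Matrix.cramer_apply, Matrix.cramer_eq_adjugate_mulVec]
    rfl
  simp only [Matrix.trace, Matrix.diag_apply, h]
  simp only [Matrix.det_apply', derivative_sum]
  rw [Finset.sum_comm]
  refine Finset.sum_congr rfl fun σ _ => ?_
  rw [derivative_mul, derivative_intCast, zero_mul, zero_add, derivative_prod_finset,
    Finset.mul_sum]
  refine Finset.sum_congr rfl fun i _ => ?_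
  rw [← Finset.mul_prod_erase _ _ (Finset.mem_univ i)]
  rw [Matrix.updateCol_self, mul_comm (derivative _)]
  congr 2
  refine Finset.prod_congr rfl fun j hj => ?_
  rw [Matrix.updateCol_ne (Finset.ne_of_mem_erase hj)]

theorem aux_nil {R : Type*} [CommRing R] {n : ℕ} (A : Matrix (Fin n) (Fin n) R)
    (hR : ∀ k : ℤ, k ≠ 0 → ∀ r : R, (k : R) * r = 0 → r = 0)
    (hA : ∀ t, 1 ≤ t → (A ^ t).trace = 0) : A ^ n = 0 := by
  set P := A.charpoly with hP
  set a := A.charmatrix.adjugate with ha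
  have hder : derivative P = a.trace := by
    rw [hP, Matrix.charpoly, aux_derivative_det]
    have : A.charmatrix.map derivative = 1 := by
      ext i j : 1
      by_cases hij : i = j
      · subst hij; simp [Matrix.charmatrix_apply]
      · simp [Matrix.charmatrix_apply, hij]
    rw [this, mul_one]
  set A' : Matrix (Fin n) (Fin n) R[X] := A.map C with hA'
  have hcm : A.charmatrix = Matrix.scalar (Fin n) (X : R[X]) - A' := rfl
  have hpow : ∀ k, A' ^ k = (A ^ k).map C := fun k => by
    rw [hA']
    exact (map_pow (C.mapMatrix) A k).symm
  -- choose a big exponent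
  set d := ∑ i, ∑ j, (a i j).natDegree with hd
  have hdeg : ∀ i j, (a i j).natDegree ≤ d := fun i j =>
    (Finset.single_le_sum (f := fun j => (a i j).natDegree) (fun _ _ => Nat.zero_le _)
      (Finset.mem_univ j)).trans
    (Finset.single_le_sum (f := fun i => ∑ j, (a i j).natDegree) (fun _ _ => Nat.zero_le _)
      (Finset.mem_univ i))
  have key : X ^ (d + 2) * derivative P - (a * A' ^ (d + 2)).trace
      = (n : R[X]) * X ^ (d + 1) * P := by
    have hc : Commute (Matrix.scalar (Fin n) (X : R[X])) A' :=
      Matrix.scalar_commute _ (fun r => Commute.all _ _) _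
    have hst : ∀ (r : R[X]) (M : Matrix (Fin n) (Fin n) R[X]),
        (Matrix.scalar (Fin n) r * M).trace = r * M.trace := by
      intro r M
      simp [Matrix.trace, Matrix.scalar_apply, Matrix.diagonal_mul, Finset.mul_sum]
    have h1 := hc.mul_geom_sum₂ (d + 2)
    have h2 : a * (Matrix.scalar (Fin n) (X : R[X]) ^ (d + 2) - A' ^ (d + 2))
        = P • ∑ i ∈ Finset.range (d + 2), Matrix.scalar (Fin n) (X : R[X]) ^ i * A' ^ (d + 2 - 1 - i) := by
      rw [← h1, ← hcm, ← mul_assoc, ha, Matrix.adjugate_mul, smul_mul_assoc, one_mul]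
      rfl
    have h3 := congrArg Matrix.trace h2
    rw [mul_sub, Matrix.trace_sub, Matrix.trace_smul, Matrix.trace_sum] at h3
    rw [← map_pow (Matrix.scalar (Fin n)) X (d+2)] at h3
    have h4 : (a * Matrix.scalar (Fin n) (X ^ (d + 2) : R[X])).trace
        = X ^ (d + 2) * derivative P := by
      rw [hder, Matrix.trace_mul_comm, hst]
    rw [h4] at h3
    rw [h3, Finset.sum_range_succ, Finset.sum_eq_zero]
    · rw [← map_pow (Matrix.scalar (Fin n)) X (d + 1), hst,
        show d + 2 - 1 - (d + 1) = 0 by omega, pow_zero, Matrix.trace_one, Fintype.card_fin,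
        zero_add, smul_eq_mul]
      ring
    · intro i hi
      rw [← map_pow (Matrix.scalar (Fin n)) X i, hst, hpow]
      have hi' := Finset.mem_range.mp hi
      have h6 : ((A ^ (d + 2 - 1 - i)).map C).trace = C (A ^ (d + 2 - 1 - i)).trace := by
        simp [Matrix.trace]
      rw [h6, hA _ (by omega), map_zero, mul_zero]
  have hcoef : ∀ k : ℕ, (((k : ℤ) - n : ℤ) : R) * P.coeff k = 0 := by
    intro k
    have h := congrArg (fun q => q.coeff (k + (d + 1))) key
    have h0 : ((a * A' ^ (d + 2)).trace).coeff (k + (d + 1)) = 0 := by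
      rw [hpow, Matrix.trace, finsetSum_coeff]
      refine Finset.sum_eq_zero fun i _ => ?_
      rw [Matrix.diag_apply, Matrix.mul_apply, finsetSum_coeff]
      refine Finset.sum_eq_zero fun j _ => ?_
      rw [Matrix.map_apply, coeff_mul_C, coeff_eq_zero_of_natDegree_lt, zero_mul]
      have := hdeg i j
      omega
    simp only [coeff_sub, h0, sub_zero] at h
    rw [show (X : R[X]) ^ (d + 2) * derivative P = (X * derivative P) * X ^ (d + 1) by ring,
      show (n : R[X]) * X ^ (d + 1) * P = ((n : R[X]) * P) * X ^ (d + 1) by ring,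
      coeff_mul_X_pow, coeff_mul_X_pow, ← C_eq_natCast, coeff_C_mul] at h
    have h5 : (X * derivative P).coeff k = k * P.coeff k := by
      cases k with
      | zero => simp
      | succ k => rw [coeff_X_mul, coeff_derivative]; push_cast; ring
    rw [h5] at h
    push_cast
    rw [sub_mul, h, sub_self]
  have hPX : P = X ^ n := by
    ext k
    rw [coeff_X_pow]
    split_ifs with hk
    · rcases subsingleton_or_nontrivial R with _ | _
      · exact Subsingleton.elim _ _
      have h1 := A.charpoly_monic
      have h2 := A.charpoly_natDegree_eq_dim
      rw [Fintype.card_fin] at h2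
      rw [Monic, leadingCoeff, h2] at h1
      rw [hk, hP, h1]
    · exact hR (k - n) (by omega) _ (hcoef k)
  have := A.aeval_self_charpoly
  rw [← hP, hPX] at this
  simpa using this

end NilAux

section Grass

variable {K V : Type*} [Field K] [CharZero K] [AddCommGroup V] [Module K V]

theorem aux_iota_mul (v : V) (x : ExteriorAlgebra K V) :
    ExteriorAlgebra.ι K v * x
      = CliffordAlgebra.involute (Q := (0 : QuadraticForm K V)) x * ExteriorAlgebra.ι K v := by
  induction x using ExteriorAlgebra.induction with
  | algebraMap r =>
    rw [AlgHom.commutes]; exact (Algebra.commutes r _).symm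
  | ι w =>
    have : CliffordAlgebra.involute (Q := (0 : QuadraticForm K V)) (ExteriorAlgebra.ι K w)
      = - ExteriorAlgebra.ι K w := CliffordAlgebra.involute_ι w
    rw [this, neg_mul]
    exact eq_neg_of_add_eq_zero_left (ExteriorAlgebra.ι_add_mul_swap v w)
  | mul a b ha hb => rw [map_mul, ← mul_assoc, ha, mul_assoc, hb, mul_assoc]
  | add a b ha hb => rw [map_add, mul_add, add_mul, ha, hb]

/-- oddness phrased by the grade involution -/
def AuxOdd (x : ExteriorAlgebra K V) : Prop :=
  CliffordAlgebra.involute (Q := (0 : QuadraticForm K V)) x = -x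

theorem AuxOdd.mul_eq {x : ExteriorAlgebra K V} (hx : AuxOdd x) (y : ExteriorAlgebra K V) :
    x * y = CliffordAlgebra.involute (Q := (0 : QuadraticForm K V)) y * x := by
  induction y using ExteriorAlgebra.induction with
  | algebraMap r =>
    rw [AlgHom.commutes]; exact (Algebra.commutes r _).symm
  | ι w =>
    have : CliffordAlgebra.involute (Q := (0 : QuadraticForm K V)) (ExteriorAlgebra.ι K w)
      = - ExteriorAlgebra.ι K w := CliffordAlgebra.involute_ι w
    rw [this, neg_mul, aux_iota_mul, hx, neg_mul, neg_neg]
  | mul a b ha hb => rw [map_mul, ← mul_assoc, ha, mul_assoc, hb, mul_assoc]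
  | add a b ha hb => rw [map_add, mul_add, add_mul, ha, hb]

theorem AuxOdd.anti {x y : ExteriorAlgebra K V} (hx : AuxOdd x) (hy : AuxOdd y) :
    x * y = -(y * x) := by
  rw [hx.mul_eq, hy, neg_mul]

theorem AuxOdd.mul_mem_center {x y : ExteriorAlgebra K V} (hx : AuxOdd x) (hy : AuxOdd y) :
    x * y ∈ Subalgebra.center K (ExteriorAlgebra K V) := by
  rw [Subalgebra.mem_center_iff]
  intro z
  rw [mul_assoc, hy.mul_eq, ← mul_assoc, hx.mul_eq, map_mul,
    CliffordAlgebra.involute_involute, hy, mul_assoc, mul_assoc, neg_mul, ← hx.anti hy]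

variable {n : ℕ}

theorem aux_pow_odd (B : Matrix (Fin n) (Fin n) (ExteriorAlgebra K V))
    (hB : ∀ i j, AuxOdd (B i j)) (k : ℕ) (i j : Fin n) : AuxOdd ((B ^ (2 * k + 1)) i j) := by
  have h1 : (CliffordAlgebra.involute (Q := (0 : QuadraticForm K V))).mapMatrix B = -B := by
    ext i j : 1
    exact hB i j
  have h2 := map_pow (CliffordAlgebra.involute (Q := (0 : QuadraticForm K V))).mapMatrix B (2*k+1)
  rw [h1, Odd.neg_pow ⟨k, rfl⟩] at h2
  exact congrFun (congrFun h2 i) j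

theorem aux_trace_even (B : Matrix (Fin n) (Fin n) (ExteriorAlgebra K V))
    (hB : ∀ i j, AuxOdd (B i j)) (t : ℕ) (ht : 1 ≤ t) : (B ^ (2 * t)).trace = 0 := by
  obtain ⟨k, rfl⟩ : ∃ k, t = k + 1 := ⟨t - 1, by omega⟩
  have h : (B * B ^ (2 * k + 1)).trace = -(B ^ (2 * k + 1) * B).trace := by
    simp only [Matrix.trace, Matrix.diag_apply, Matrix.mul_apply]
    rw [Finset.sum_comm, ← Finset.sum_neg_distrib]
    refine Finset.sum_congr rfl fun i _ => ?_
    rw [← Finset.sum_neg_distrib]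
    refine Finset.sum_congr rfl fun j _ => ?_
    exact (hB _ _).anti (aux_pow_odd B hB k _ _)
  rw [← pow_succ, ← pow_succ'] at h
  have h2 : (2 : K) • (B ^ (2 * k + 1 + 1)).trace = 0 := by
    rw [two_smul]; nth_rewrite 1 [h]; simp
  exact (smul_eq_zero.mp h2).resolve_left two_ne_zero

theorem aux_AL (B : Matrix (Fin n) (Fin n) (ExteriorAlgebra K V))
    (hB : ∀ i j, AuxOdd (B i j)) : B ^ (2 * n) = 0 := by
  have hmem : ∀ i j, (B ^ 2) i j ∈ Subalgebra.center K (ExteriorAlgebra K V) := by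
    intro i j
    rw [pow_two, Matrix.mul_apply]
    exact Subalgebra.sum_mem _ fun k _ => (hB _ _).mul_mem_center (hB _ _)
  let f := (Subalgebra.center K (ExteriorAlgebra K V)).val
  let A : Matrix (Fin n) (Fin n) (Subalgebra.center K (ExteriorAlgebra K V)) :=
    fun i j => ⟨(B ^ 2) i j, hmem i j⟩
  have hA : ∀ k, f.mapMatrix (A ^ k) = B ^ (2 * k) := by
    intro k
    rw [map_pow, pow_mul]
    rfl
  have := aux_nil A ?_ ?_
  · rw [← hA, this, map_zero]
  · intro k hk r hr
    have : (k : K) • r = 0 := by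
      rw [Algebra.smul_def, map_intCast, hr]
    exact (smul_eq_zero.mp this).resolve_left (by exact_mod_cast hk)
  · intro t ht
    apply Subtype.ext
    have h := aux_trace_even B hB t ht
    rw [← hA] at h
    have h7 : (f.mapMatrix (A ^ t)).trace = f (A ^ t).trace := by
      simp [Matrix.trace]
    exact h7.symm.trans h

theorem aux_expand {R : Type*} [Ring R] (B X T : R) (hT : T * T = 0) (hB : B * T = -(T * B))
    (hX : X * T = T * X) (m : ℕ) :
    (B + T * X) ^ m = B ^ m
      + T * ∑ k ∈ Finset.range m, (-1) ^ k * (B ^ k * X * B ^ (m - 1 - k)) := by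
  have hBk : ∀ k, B ^ k * T = (-1) ^ k * (T * B ^ k) := by
    intro k
    induction k with
    | zero => simp
    | succ k ih =>
      rw [pow_succ, mul_assoc, hB, mul_neg, ← mul_assoc, ih, pow_succ]; simp [mul_assoc]
  have hk2 : ∀ k : ℕ, ∀ y : R, T * ((-1) ^ k * y) = (-1) ^ k * (T * y) := by
    intro k y
    rw [← mul_assoc, ← mul_assoc, ((Commute.neg_one_right T).pow_right k).eq]
  induction m with
  | zero => simp
  | succ m ih =>
    have hs : ∑ k ∈ Finset.range (m + 1), (-1) ^ k * (B ^ k * X * B ^ (m + 1 - 1 - k))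
        = (∑ k ∈ Finset.range m, (-1) ^ k * (B ^ k * X * B ^ (m - 1 - k))) * B
          + (-1) ^ m * (B ^ m * X) := by
      rw [Finset.sum_range_succ, Finset.sum_mul]
      congr 1
      · refine Finset.sum_congr rfl fun k hk => ?_
        have := Finset.mem_range.mp hk
        rw [show m + 1 - 1 - k = (m - 1 - k) + 1 by omega, pow_succ]
        simp only [mul_assoc]
      · simp
    have hz : T * (∑ k ∈ Finset.range m, (-1) ^ k * (B ^ k * X * B ^ (m - 1 - k))) * T = 0 := by
      rw [Finset.mul_sum, Finset.sum_mul]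
      refine Finset.sum_eq_zero fun k _ => ?_
      rw [hk2]
      simp only [mul_assoc]
      rw [hBk, ← mul_assoc X, ((Commute.neg_one_right X).pow_right _).eq, mul_assoc,
        ← mul_assoc X, hX]
      simp only [← mul_assoc]
      rw [mul_assoc _ (B ^ k), ((Commute.neg_one_right (B ^ k)).pow_right _).eq]
      simp only [mul_assoc]
      rw [← mul_assoc (B ^ k), hBk]
      simp only [mul_assoc]
      rw [hk2, hk2, ← mul_assoc T T, hT]
      simp
    rw [pow_succ, ih, hs, mul_add, add_mul, add_mul, mul_add T, ← mul_assoc _ T X, ← mul_assoc _ T X,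
      hz, hBk, hk2]
    simp only [mul_assoc, pow_succ]
    noncomm_ring

end Grass

section Main

variable {K : Type*} [Field K] [CharZero K] {n : ℕ}

/-- shift of generators -/
noncomputable def auxShift (K : Type*) [Field K] :
    ExteriorAlgebra K (ℕ →₀ K) →ₐ[K] ExteriorAlgebra K (ℕ →₀ K) :=
  ExteriorAlgebra.map (Finsupp.lmapDomain K K Nat.succ)

theorem auxShift_inj : Function.Injective (auxShift K) := by
  apply ExteriorAlgebra.map_injective_field
  rw [LinearMap.ker_eq_bot]
  exact Finsupp.mapDomain_injective Nat.succ_injective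

theorem auxShift_odd {x : ExteriorAlgebra K (ℕ →₀ K)} (hx : AuxOdd x) :
    AuxOdd (auxShift K x) := by
  have h : (CliffordAlgebra.involute (Q := (0 : QuadraticForm K (ℕ →₀ K)))).comp (auxShift K)
      = (auxShift K).comp (CliffordAlgebra.involute (Q := (0 : QuadraticForm K (ℕ →₀ K)))) := by
    apply ExteriorAlgebra.hom_ext
    refine LinearMap.ext fun v => ?_
    change CliffordAlgebra.involute (Q := (0 : QuadraticForm K (ℕ →₀ K)))
        (auxShift K (ExteriorAlgebra.ι K v))
      = auxShift K (CliffordAlgebra.involute (Q := (0 : QuadraticForm K (ℕ →₀ K)))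
        (ExteriorAlgebra.ι K v))
    have h1 : ∀ w : ℕ →₀ K, CliffordAlgebra.involute (Q := (0 : QuadraticForm K (ℕ →₀ K)))
        (ExteriorAlgebra.ι K w) = - ExteriorAlgebra.ι K w :=
      fun w => CliffordAlgebra.involute_ι w
    rw [h1, map_neg, auxShift, ExteriorAlgebra.map_apply_ι, h1]
  have h2 := DFunLike.congr_fun h x
  change CliffordAlgebra.involute (Q := (0 : QuadraticForm K (ℕ →₀ K))) (auxShift K x)
    = auxShift K (CliffordAlgebra.involute (Q := (0 : QuadraticForm K (ℕ →₀ K))) x) at h2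
  rw [hx, map_neg] at h2
  exact h2

theorem auxShift_contract (x : ExteriorAlgebra K (ℕ →₀ K)) :
    CliffordAlgebra.contractLeft (Q := (0 : QuadraticForm K (ℕ →₀ K)))
      (Finsupp.lapply 0 : (ℕ →₀ K) →ₗ[K] K) (auxShift K x) = 0 := by
  induction x using CliffordAlgebra.left_induction with
  | algebraMap r =>
    have : auxShift K (algebraMap K (ExteriorAlgebra K (ℕ →₀ K)) r) = algebraMap K _ r :=
      AlgHom.commutes _ r
    exact (congrArg _ this).trans (CliffordAlgebra.contractLeft_algebraMap _ _ r)
  | add x y hx hy =>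
    have : auxShift K (x + y) = auxShift K x + auxShift K y := map_add _ _ _
    refine (congrArg _ this).trans ?_
    rw [map_add, hx, hy, add_zero]
  | ι_mul x m hx =>
    have : auxShift K (CliffordAlgebra.ι (0 : QuadraticForm K (ℕ →₀ K)) m * x)
        = CliffordAlgebra.ι (0 : QuadraticForm K (ℕ →₀ K)) (Finsupp.mapDomain Nat.succ m)
          * auxShift K x := by
      refine (map_mul (auxShift K) _ _).trans ?_
      congr 1
      exact ExteriorAlgebra.map_apply_ι _ _
    refine (congrArg _ this).trans ?_
    rw [CliffordAlgebra.contractLeft_ι_mul, hx, mul_zero, sub_zero]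
    have h0 : (Finsupp.lapply 0 : (ℕ →₀ K) →ₗ[K] K) (Finsupp.mapDomain Nat.succ m) = 0 := by
      rw [Finsupp.lapply_apply]
      exact Finsupp.mapDomain_of_notMem_range _ _ (by simp)
    rw [h0, zero_smul]

theorem auxShift_cancel (x : ExteriorAlgebra K (ℕ →₀ K))
    (h : ExteriorAlgebra.ι K (Finsupp.single 0 1) * auxShift K x = 0) : x = 0 := by
  have h1 := CliffordAlgebra.contractLeft_ι_mul (Q := (0 : QuadraticForm K (ℕ →₀ K)))
    (d := (Finsupp.lapply 0 : (ℕ →₀ K) →ₗ[K] K)) (Finsupp.single 0 1) (auxShift K x)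
  rw [auxShift_contract, mul_zero, sub_zero] at h1
  have h2 : CliffordAlgebra.ι (0 : QuadraticForm K (ℕ →₀ K)) (Finsupp.single 0 1) * auxShift K x
    = 0 := h
  rw [h2, map_zero] at h1
  have h3 : auxShift K x = 0 := by simpa using h1.symm
  exact auxShift_inj (h3.trans (map_zero _).symm)

theorem aux_linearized (B : Matrix (Fin n) (Fin n) (ExteriorAlgebra K (ℕ →₀ K)))
    (hB : ∀ i j, AuxOdd (B i j)) (p q : Fin n) :
    ∑ k ∈ Finset.range (2 * n), (-1) ^ k * (B ^ k * Matrix.single p q 1 * B ^ (2 * n - 1 - k))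
      = 0 := by
  set θ : ExteriorAlgebra K (ℕ →₀ K) := ExteriorAlgebra.ι K (Finsupp.single 0 1) with hθ
  have hθodd : AuxOdd θ := CliffordAlgebra.involute_ι _
  set T : Matrix (Fin n) (Fin n) (ExteriorAlgebra K (ℕ →₀ K)) := Matrix.diagonal fun _ => θ with hT
  set B' := (auxShift K).mapMatrix B with hB'
  have hB'odd : ∀ i j, AuxOdd (B' i j) := fun i j => auxShift_odd (hB i j)
  set X : Matrix (Fin n) (Fin n) (ExteriorAlgebra K (ℕ →₀ K)) := Matrix.single p q 1 with hX
  have hXs : (auxShift K).mapMatrix X = X := by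
    ext i j : 1
    simp [hX, Matrix.single_apply, apply_ite (auxShift K)]
  have e := aux_expand B' X T ?_ ?_ ?_ (2 * n)
  · rw [aux_AL B' hB'odd, aux_AL, zero_add] at e
    · have e2 : ∑ k ∈ Finset.range (2 * n), (-1) ^ k * (B' ^ k * X * B' ^ (2 * n - 1 - k))
        = (auxShift K).mapMatrix (∑ k ∈ Finset.range (2 * n),
            (-1) ^ k * (B ^ k * X * B ^ (2 * n - 1 - k))) := by
        simp only [map_sum, map_mul, map_pow, map_neg, map_one, hXs, hB']
      rw [e2] at e
      ext i j : 1
      apply auxShift_cancel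
      have e3 := congrFun (congrFun e i) j
      rw [hT, Matrix.diagonal_mul] at e3
      exact e3.symm
    · intro i j
      have : (B' + T * X) i j = B' i j + θ * X i j := by
        rw [Matrix.add_apply, hT, Matrix.diagonal_mul]
      rw [this]
      unfold AuxOdd
      rw [map_add, map_mul, hθodd, hB'odd i j]
      have : CliffordAlgebra.involute (Q := (0 : QuadraticForm K (ℕ →₀ K))) (X i j) = X i j := by
        simp only [hX, Matrix.single_apply]
        split_ifs
        · exact map_one _
        · exact map_zero _
      rw [this, neg_mul, neg_add]
  · rw [hT, Matrix.diagonal_mul_diagonal]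
    have : θ * θ = 0 := ExteriorAlgebra.ι_sq_zero _
    simp [this]
  · ext i j : 1
    rw [hT, Matrix.mul_diagonal, Matrix.neg_apply, Matrix.diagonal_mul]
    exact (hB'odd i j).anti hθodd
  · ext i j : 1
    rw [hT, Matrix.mul_diagonal, Matrix.diagonal_mul, hX, Matrix.single_apply]
    split_ifs <;> simp

theorem aux_contracted (B : Matrix (Fin n) (Fin n) (ExteriorAlgebra K (ℕ →₀ K)))
    (hB : ∀ i j, AuxOdd (B i j)) (p q : Fin n) :
    ∑ k ∈ Finset.range (2 * n), (-1) ^ k * ((B ^ k).trace * (B ^ (2 * n - 1 - k)) p q) = 0 := by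
  have h : ∑ i, (∑ k ∈ Finset.range (2 * n),
      (-1) ^ k * (B ^ k * Matrix.single i p 1 * B ^ (2 * n - 1 - k)) :
        Matrix (Fin n) (Fin n) (ExteriorAlgebra K (ℕ →₀ K))) i q = 0 :=
    Finset.sum_eq_zero fun i _ => by rw [aux_linearized B hB]; rfl
  rw [← h]
  simp only [Matrix.sum_apply]
  rw [Finset.sum_comm]
  refine Finset.sum_congr rfl fun k _ => ?_
  have h1 : ∀ M : Matrix (Fin n) (Fin n) (ExteriorAlgebra K (ℕ →₀ K)), ∀ i,
      ((-1) ^ k * M) i q = (-1) ^ k * M i q := by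
    intro M i
    rcases neg_one_pow_eq_or (Matrix (Fin n) (Fin n) (ExteriorAlgebra K (ℕ →₀ K))) k with h | h <;>
    rcases Nat.even_or_odd k with hk | hk <;> simp [hk.neg_one_pow]
  simp only [h1, ← Finset.mul_sum]
  congr 1
  rw [Matrix.trace, Finset.sum_mul]
  refine Finset.sum_congr rfl fun i _ => ?_
  rw [Matrix.mul_apply, Finset.sum_eq_single p]
  · simp
  · intro j _ hj
    rw [Matrix.mul_single_apply_of_ne _ _ _ _ _ hj, zero_mul]
  · simp

end Main

/-- If `B ∈ Mₙ(E₁)`, `n ≥ 2`, and `tr(Bᵗ) = 0` for `1 ≤ t ≤ 2n−2`, then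
`n·B^{2n−1} = tr(B^{2n−1})·Iₙ`; if moreover `tr(B^{2n−1}) = 0` then `B^{2n−1} = 0`. -/
theorem grassmann_odd_scalar_power
    {K : Type*} [Field K] [CharZero K] {n : ℕ} (hn : 2 ≤ n)
    (B : Matrix (Fin n) (Fin n) (ExteriorAlgebra K (ℕ →₀ K)))
    (hB : ∀ i j, B i j ∈ CliffordAlgebra.evenOdd (0 : QuadraticForm K (ℕ →₀ K)) 1)
    (htr : ∀ t, 1 ≤ t → t ≤ 2 * n - 2 → (B ^ t).trace = 0) :
    n • B ^ (2 * n - 1)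
      = (B ^ (2 * n - 1)).trace
          • (1 : Matrix (Fin n) (Fin n) (ExteriorAlgebra K (ℕ →₀ K)))
    ∧ ((B ^ (2 * n - 1)).trace = 0 → B ^ (2 * n - 1) = 0) := by
  have hBo : ∀ i j, AuxOdd (B i j) := fun i j => CliffordAlgebra.involute_eq_of_mem_odd (hB i j)
  have main : n • B ^ (2 * n - 1)
      = (B ^ (2 * n - 1)).trace
          • (1 : Matrix (Fin n) (Fin n) (ExteriorAlgebra K (ℕ →₀ K))) := by
    ext p q : 1
    have h := aux_contracted B hBo p q
    obtain ⟨m, rfl⟩ : ∃ m, n = m + 1 := ⟨n - 1, by omega⟩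
    rw [show 2 * (m + 1) = (2 * m + 1) + 1 by ring, Finset.sum_range_succ,
      Finset.sum_range_succ', Finset.sum_eq_zero] at h
    · have e : 2 * (m + 1) - 1 = 2 * m + 1 := by omega
      rw [e]
      have ho : (-1 : ExteriorAlgebra K (ℕ →₀ K)) ^ (2 * m + 1) = -1 :=
        Odd.neg_one_pow ⟨m, rfl⟩
      simp only [ho, Nat.add_sub_cancel, Nat.sub_zero, Nat.sub_self, pow_zero, zero_add, one_mul,
        neg_mul, Matrix.trace_one, Fintype.card_fin] at h
      rw [Matrix.smul_apply, Matrix.smul_apply, smul_eq_mul, nsmul_eq_mul]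
      exact eq_of_sub_eq_zero (by rw [sub_eq_add_neg]; exact h)
    · intro k hk
      have := Finset.mem_range.mp hk
      rw [htr (k + 1) (by omega) (by omega), zero_mul, mul_zero]
  refine ⟨main, fun h0 => ?_⟩
  rw [h0, zero_smul] at main
  have h2 : (n : K) • B ^ (2 * n - 1) = 0 := by rw [Nat.cast_smul_eq_nsmul, main]
  exact (smul_eq_zero.mp h2).resolve_left (by exact_mod_cast (by omega : n ≠ 0))
end

section
/- Let E be the infinite-dimensional Grassmann algebra over a field K of characteristic zero and let n ≥ 1. If B ∈ Mₙ(E₁) satisfies tr(B²) = tr(B⁴) = ... = tr(B^{2n}) = 0, then B^{2n} = 0. -/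
open Matrix

lemma aux_derivative_det_s4 {R : Type*} [CommRing R] {n : ℕ} (M : Matrix (Fin n) (Fin n) (Polynomial R)) :
    Polynomial.derivative M.det =
      ∑ i, (M.updateCol i (fun k => Polynomial.derivative (M k i))).det := by
  simp only [Matrix.det_apply, Polynomial.derivative_sum]
  rw [Finset.sum_comm]
  refine Finset.sum_congr rfl fun σ _ => ?_
  rw [← Finset.smul_sum, Units.smul_def, Units.smul_def, map_zsmul]
  congr 1
  rw [Polynomial.derivative_prod_finset]
  refine Finset.sum_congr rfl fun i _ => ?_
  rw [← Finset.prod_erase_mul Finset.univ _ (Finset.mem_univ i)]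
  congr 1
  · refine Finset.prod_congr rfl fun j hj => ?_
    rw [Matrix.updateCol_ne (Finset.ne_of_mem_erase hj)]
  · rw [Matrix.updateCol_self]

lemma aux_derivative_charpoly {R : Type*} [CommRing R] {n : ℕ} (A : Matrix (Fin n) (Fin n) R) :
    Polynomial.derivative A.charpoly = A.charmatrix.adjugate.trace := by
  rw [Matrix.charpoly, ← Matrix.det_transpose, aux_derivative_det_s4, Matrix.trace]
  refine Finset.sum_congr rfl fun i _ => ?_
  rw [Matrix.diag_apply, Matrix.adjugate_def, Matrix.of_apply, Matrix.cramer_apply]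
  congr 2
  funext k
  rw [Matrix.transpose_apply]
  by_cases h : k = i
  · subst h; simp [Matrix.charmatrix_apply_eq]
  · rw [Matrix.charmatrix_apply_ne _ _ _ (Ne.symm h)]; simp [h]

lemma aux_nilpotent {K R : Type*} [Field K] [CharZero K] [CommRing R] [Algebra K R] {n : ℕ}
    (A : Matrix (Fin n) (Fin n) R) (htr : ∀ i, 1 ≤ i → i ≤ n → (A ^ i).trace = 0) :
    A ^ n = 0 := by
  nontriviality R
  have hcancel : ∀ (m : ℕ) (x : R), m ≠ 0 → (m : R) * x = 0 → x = 0 := by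
    intro m x hm h
    have h2 : (m : K) • x = 0 := by rw [Algebra.smul_def, map_natCast, h]
    exact (smul_eq_zero.mp h2).resolve_left (Nat.cast_ne_zero.mpr hm)
  set p := A.charpoly with hp
  set Q := matPolyEquiv A.charmatrix.adjugate with hQ
  have hmul : (Polynomial.X - Polynomial.C A) * Q = p.map (algebraMap R (Matrix (Fin n) (Fin n) R)) := by
    rw [← Matrix.matPolyEquiv_charmatrix, hQ, ← map_mul, Matrix.mul_adjugate, hp, Matrix.charpoly,
      matPolyEquiv_smul_one]
  have htrQ : ∀ k, (Q.coeff k).trace = p.coeff (k + 1) * ((k : R) + 1) := by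
    intro k
    rw [← Polynomial.coeff_derivative, hp, aux_derivative_charpoly, Matrix.trace, Matrix.trace,
      Polynomial.finset_sum_coeff]
    refine Finset.sum_congr rfl fun i _ => ?_
    rw [Matrix.diag_apply, Matrix.diag_apply, hQ, matPolyEquiv_coeff_apply]
  have hs : ∀ k, Q.coeff k = A * Q.coeff (k + 1) + algebraMap R _ (p.coeff (k + 1)) := by
    intro k
    have := congrArg (fun q => Polynomial.coeff q (k + 1)) hmul
    simp only [sub_mul, Polynomial.coeff_sub, Polynomial.coeff_X_mul, Polynomial.coeff_C_mul,
      Polynomial.coeff_map] at this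
    rw [← this]; abel
  have h0 : 0 = A * Q.coeff 0 + algebraMap R _ (p.coeff 0) := by
    have := congrArg (fun q => Polynomial.coeff q 0) hmul
    simp only [sub_mul, Polynomial.coeff_sub, Polynomial.coeff_X_mul_zero, Polynomial.coeff_C_mul,
      Polynomial.coeff_map] at this
    rw [← this]; abel
  have hdeg : p.natDegree = n := by rw [hp, Matrix.charpoly_natDegree_eq_dim, Fintype.card_fin]
  have hlead : p.coeff n = 1 := by
    have := (Matrix.charpoly_monic A).coeff_natDegree
    rwa [← hp, hdeg] at this
  have hbig : ∀ d k, n ≤ k → Q.natDegree < k + d → Q.coeff k = 0 := by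
    intro d
    induction d with
    | zero => intro k _ h; exact Polynomial.coeff_eq_zero_of_natDegree_lt h
    | succ d ih =>
      intro k hk h
      rw [hs k, ih (k + 1) (by omega) (by omega),
        Polynomial.coeff_eq_zero_of_natDegree_lt (by omega)]
      simp
  have hbig' : ∀ k, n ≤ k → Q.coeff k = 0 := fun k hk => hbig (Q.natDegree + 1) k hk (by omega)
  have key : ∀ j, j < n → Q.coeff (n - 1 - j) = A ^ j := by
    intro j
    induction j with
    | zero =>
      intro h
      rw [hs, show n - 1 - 0 + 1 = n by omega, hbig' n le_rfl, hlead]; simp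
    | succ j ih =>
      intro h
      have e := hs (n - 1 - (j + 1))
      rw [show n - 1 - (j + 1) + 1 = n - 1 - j by omega, ih (by omega), ← pow_succ'] at e
      have t := htrQ (n - 1 - (j + 1))
      rw [e, Matrix.trace_add, htr (j + 1) (by omega) (by omega),
        show n - 1 - (j + 1) + 1 = n - 1 - j by omega, Matrix.algebraMap_eq_diagonal,
        Matrix.trace_diagonal] at t
      have hz : p.coeff (n - 1 - j) = 0 := by
        apply hcancel (j + 1) _ (by omega)
        have hn : (n : R) = ((n - 1 - (j + 1) : ℕ) : R) + 1 + ((j + 1 : ℕ) : R) := by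
          have : n = (n - 1 - (j + 1)) + 1 + (j + 1) := by omega
          exact_mod_cast congrArg (Nat.cast (R := R)) this
        simp at t
        rw [hn] at t
        push_cast at t ⊢
        linear_combination t
      rw [e, hz]; simp
  rcases Nat.eq_zero_or_pos n with hn | hn
  · subst hn; exact Subsingleton.elim _ _
  have k0 := key (n - 1) (by omega)
  rw [Nat.sub_self] at k0
  rw [k0, ← pow_succ', Nat.sub_add_cancel hn] at h0
  have t := congrArg Matrix.trace h0
  rw [Matrix.trace_add, htr n hn le_rfl, Matrix.algebraMap_eq_diagonal,
        Matrix.trace_diagonal] at t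
  have hz : p.coeff 0 = 0 := by
    apply hcancel n _ (by omega)
    simpa using t.symm
  rw [hz] at h0
  simpa using h0.symm

lemma aux_central {K M : Type*} [Field K] [AddCommGroup M] [Module K M]
    (x : ExteriorAlgebra K M)
    (hx : x ∈ CliffordAlgebra.evenOdd (0 : QuadraticForm K M) 0) (y : ExteriorAlgebra K M) :
    Commute x y := by
  have h2 : ∀ (a b : M) (y : ExteriorAlgebra K M),
      Commute (ExteriorAlgebra.ι K a * ExteriorAlgebra.ι K b) y := by
    intro a b y
    induction y using ExteriorAlgebra.induction with
    | algebraMap r => exact (Algebra.commutes r _).symm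
    | ι c =>
      have h1 := eq_neg_of_add_eq_zero_left (ExteriorAlgebra.ι_add_mul_swap (R := K) b c)
      have h3 := eq_neg_of_add_eq_zero_left (ExteriorAlgebra.ι_add_mul_swap (R := K) a c)
      rw [Commute, SemiconjBy, mul_assoc, h1, mul_neg, ← mul_assoc, h3, neg_mul, neg_neg, mul_assoc]
    | mul u v hu hv => exact hu.mul_right hv
    | add u v hu hv => exact hu.add_right hv
  induction x, hx using CliffordAlgebra.even_induction with
  | algebraMap r => exact Algebra.commutes r _
  | add u v _ _ hu hv => exact Commute.add_left hu hv
  | ι_mul_ι_mul a b u _ hu => exact Commute.mul_left (h2 a b y) hu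



/-- If `B ∈ Mₙ(E₁)` with `tr(B²) = tr(B⁴) = ⋯ = tr(B^{2n}) = 0`, then `B^{2n} = 0`. -/
theorem grassmann_odd_even_traces_nilpotent
    {K : Type*} [Field K] [CharZero K] {n : ℕ} (hn : 1 ≤ n)
    (B : Matrix (Fin n) (Fin n) (ExteriorAlgebra K (ℕ →₀ K)))
    (hB : ∀ i j, B i j ∈ CliffordAlgebra.evenOdd (0 : QuadraticForm K (ℕ →₀ K)) 1)
    (htr : ∀ i, 1 ≤ i → i ≤ n → (B ^ (2 * i)).trace = 0) :
    B ^ (2 * n) = 0 := by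

  have hc : ∀ i j, (B ^ 2) i j ∈ Subalgebra.center K (ExteriorAlgebra K (ℕ →₀ K)) := by
    intro i j
    rw [Subalgebra.mem_center_iff]
    intro y
    refine (aux_central _ ?_ y).eq.symm
    rw [pow_two, Matrix.mul_apply]
    refine Submodule.sum_mem _ fun k _ => ?_
    exact CliffordAlgebra.evenOdd_mul_le (0 : QuadraticForm K (ℕ →₀ K)) 1 1
      (Submodule.mul_mem_mul (hB i k) (hB k j))
  let f := (Subalgebra.center K (ExteriorAlgebra K (ℕ →₀ K))).val
  let A : Matrix (Fin n) (Fin n) (Subalgebra.center K (ExteriorAlgebra K (ℕ →₀ K))) :=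
    Matrix.of fun i j => ⟨(B ^ 2) i j, hc i j⟩
  have hA : f.mapMatrix A = B ^ 2 := by ext i j; rfl
  have hAk : ∀ k, f.mapMatrix (A ^ k) = B ^ (2 * k) := by
    intro k; rw [map_pow, hA, pow_mul]
  have hf : Function.Injective f := Subtype.val_injective
  have hmain : A ^ n = 0 := by
    refine aux_nilpotent (K := K) A fun i h1 h2 => hf ?_
    rw [map_zero, ← htr i h1 h2, ← hAk i]
    simp [Matrix.trace]
  rw [← hAk n, hmain, map_zero]
end

section
/- Let E be the infinite-dimensional Grassmann algebra over a field K of characteristic zero, A ∈ Mₙ(E₀) and B ∈ Mₙ(E₁). Define α₀,...,αₙ ∈ E₀ as the coefficients of the characteristic polynomial det(xI − A) = ∑ₖ αₖxᵏ (so αₙ = 1), and define β₀,...,βₙ ∈ E₁ by βₙ = 0 and the descending recursion βₖ = −(1/(n−k))·( ∑_{i=1}^{n−k} β_{k+i}·tr(Aⁱ) + ∑_{r+s ≤ n−k−1, r,s ≥ 0} α_{k+r+s+1}·tr(A^r B A^s) ) for 0 ≤ k ≤ n−1. Then the ℤ₂-graded Cayley–Hamilton trace identity holds: β₀·Iₙ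 + ∑_{k=1}^{n} ( βₖ·Aᵏ + αₖ·(A^{k−1}B + A^{k−2}BA + ⋯ + ABA^{k−2} + BA^{k−1}) ) = 0. -/
open Matrix

namespace GCH

open Polynomial Finset

lemma derivative_charpoly {S : Type*} [CommRing S] {n : ℕ} (M : Matrix (Fin n) (Fin n) S) :
    derivative M.charpoly = (adjugate (charmatrix M)).trace := by
  classical
  have h1 : ∀ i, (adjugate (charmatrix M)) i i
      = ((charmatrix M).updateCol i (Pi.single i 1)).det := by
    intro i
    rw [← transpose_apply (adjugate _), adjugate_transpose, adjugate_apply, updateRow_transpose,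
      det_transpose]
  unfold Matrix.trace
  simp only [diag_apply, h1]
  rw [Matrix.charpoly, det_apply, derivative_sum]
  simp only [det_apply]
  rw [Finset.sum_comm]
  refine Finset.sum_congr rfl fun σ _ => ?_
  rw [← Finset.smul_sum]
  have : derivative (Equiv.Perm.sign σ • ∏ i, charmatrix M (σ i) i)
    = Equiv.Perm.sign σ • derivative (∏ i, charmatrix M (σ i) i) := by
    rcases Int.units_eq_one_or (Equiv.Perm.sign σ) with h | h <;> simp [h]
  rw [this, derivative_prod_finset]
  congr 1
  refine Finset.sum_congr rfl fun i _ => ?_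
  rw [← Finset.mul_prod_erase univ _ (Finset.mem_univ i), mul_comm]
  congr 1
  · simp only [charmatrix_apply, updateCol_self, derivative_sub, derivative_C, sub_zero]
    by_cases h : σ i = i
    · simp [h]
    · simp [h]
  · refine Finset.prod_congr rfl fun k hk => ?_
    rw [updateCol_ne (Finset.ne_of_mem_erase hk)]

lemma adj_coeff {S : Type*} [CommRing S] {n : ℕ} (M : Matrix (Fin n) (Fin n) S) (k : ℕ) :
    (matPolyEquiv (adjugate (charmatrix M))).coeff k =
      M.charpoly.coeff (k+1) • (1 : Matrix (Fin n) (Fin n) S)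
        + M * (matPolyEquiv (adjugate (charmatrix M))).coeff (k+1) := by
  have h := congrArg matPolyEquiv (mul_adjugate (charmatrix M))
  rw [map_mul, matPolyEquiv_charmatrix] at h
  have h2 := congrArg (fun p => p.coeff (k+1)) h
  simp only [sub_mul, coeff_sub, coeff_X_mul, coeff_C_mul] at h2
  rw [sub_eq_iff_eq_add] at h2
  rw [h2]
  congr 1
  ext i j
  rw [matPolyEquiv_coeff_apply]
  by_cases hij : i = j
  · simp [hij, Matrix.charpoly]
  · simp [hij]

lemma adj_coeff_sum {S : Type*} [CommRing S] {n : ℕ} (M : Matrix (Fin n) (Fin n) S) (k N : ℕ) :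
    (matPolyEquiv (adjugate (charmatrix M))).coeff k =
      ∑ i ∈ range N, M.charpoly.coeff (k+1+i) • M ^ i
        + M ^ N * (matPolyEquiv (adjugate (charmatrix M))).coeff (k+N) := by
  induction N with
  | zero => simp
  | succ N ih =>
    rw [ih, sum_range_succ, adj_coeff M (k+N), mul_add, pow_succ, mul_assoc, add_assoc,
      mul_smul_comm, mul_one]
    rw [show k + 1 + N = k + N + 1 by ring, ← add_assoc k N 1, ← add_assoc]

lemma coeff_big {S : Type*} [CommRing S] {n : ℕ} (M : Matrix (Fin n) (Fin n) S) (k : ℕ)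
    (hk : n < k) : M.charpoly.coeff k = 0 := by
  nontriviality S
  apply coeff_eq_zero_of_natDegree_lt
  simpa using hk

lemma newton {S : Type*} [CommRing S] {n : ℕ} (M : Matrix (Fin n) (Fin n) S) (k : ℕ)
    (hk : k ≤ n) :
    (k : S) * M.charpoly.coeff k
      = ∑ i ∈ range (n - k + 1), M.charpoly.coeff (k + i) * (M ^ i).trace := by
  nontriviality S
  cases k with
  | zero =>
    have h := congrArg Matrix.trace (aeval_self_charpoly M)
    rw [aeval_eq_sum_range' (n := n + 1) (by simp)] at h
    simp only [trace_sum, trace_smul, smul_eq_mul, trace_zero] at h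
    simp [h]
  | succ k =>
    have h := congrArg (fun p => p.coeff k) (derivative_charpoly M)
    simp only [coeff_derivative] at h
    have h3 : ((adjugate (charmatrix M)).trace).coeff k
        = ((matPolyEquiv (adjugate (charmatrix M))).coeff k).trace := by
      simp [Matrix.trace, matPolyEquiv_coeff_apply]
    set N := (matPolyEquiv (adjugate (charmatrix M))).natDegree + 1 with hN
    rw [h3, adj_coeff_sum M k (n - (k+1) + 1 + N),
      coeff_eq_zero_of_natDegree_lt (n := k + (n - (k+1) + 1 + N)) (by omega), mul_zero, add_zero,
      sum_range_add, sum_eq_zero (s := range N)] at h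
    · rw [add_zero] at h
      rw [mul_comm]
      push_cast
      rw [h]
      simp [trace_sum]
    · intro x _
      rw [coeff_big _ _ (by omega), zero_smul]

lemma newton' {S : Type*} [CommRing S] {n : ℕ} (M : Matrix (Fin n) (Fin n) S) (k : ℕ)
    (hk : k < n) :
    ((n - k : ℕ) : S) * M.charpoly.coeff k
      = - ∑ i ∈ Icc 1 (n - k), M.charpoly.coeff (k + i) * (M ^ i).trace := by
  have h := newton M k hk.le
  rw [sum_range_succ'] at h
  have h2 : ∑ i ∈ Icc 1 (n - k), M.charpoly.coeff (k + i) * (M ^ i).trace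
      = ∑ i ∈ range (n - k), M.charpoly.coeff (k + (i+1)) * (M ^ (i+1)).trace := by
    rw [range_eq_Ico, sum_Ico_add' (fun i => M.charpoly.coeff (k + i) * (M ^ i).trace) 0 (n-k) 1]
    rfl
  rw [h2, Nat.cast_sub hk.le]
  simp only [pow_zero, trace_one, Fintype.card_fin, add_zero] at h
  linear_combination -h

lemma newton_smul {K S : Type*} [Field K] [CharZero K] [CommRing S] [Algebra K S] {n : ℕ}
    (M : Matrix (Fin n) (Fin n) S) (k : ℕ) (hk : k < n) :
    M.charpoly.coeff k = -((((n - k : ℕ) : K))⁻¹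
        • ∑ i ∈ Finset.Icc 1 (n - k), M.charpoly.coeff (k + i) * (M ^ i).trace) := by
  have h := newton' M k hk
  have h0 : ((n - k : ℕ) : K) ≠ 0 := by
    rw [Nat.cast_ne_zero]; omega
  rw [← smul_neg, ← h, ← nsmul_eq_mul, ← Nat.cast_smul_eq_nsmul K, smul_smul, inv_mul_cancel₀ h0,
    one_smul]

/-- Uniqueness of descending recursion. -/
lemma desc_induction {n : ℕ} {P : ℕ → Prop} (hn : P n)
    (h : ∀ k < n, (∀ j, k < j → j ≤ n → P j) → P k) : ∀ k ≤ n, P k := by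
  intro k hk
  obtain ⟨m, hm⟩ : ∃ m, m = n - k := ⟨_, rfl⟩
  induction m using Nat.strong_induction_on generalizing k with
  | _ m ih =>
    rcases hk.eq_or_lt with rfl | hlt
    · exact hn
    · exact h k hlt fun j hj hjn => ih (n - j) (by omega) j hjn rfl

lemma main_aux {K S E : Type*} [Field K] [CharZero K] [CommRing S] [Algebra K S]
    [Ring E] [Algebra K E] (φ : S →ₐ[K] E) (ψ : S →ₗ[K] E)
    (hψ : ∀ x y, ψ (x * y) = φ x * ψ y + ψ x * φ y) {n : ℕ}
    (M : Matrix (Fin n) (Fin n) S) (A B : Matrix (Fin n) (Fin n) E)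
    (hA : M.map φ = A) (hB : M.map ψ = B)
    (α β : ℕ → E)
    (hαn : α n = 1)
    (hα : ∀ k < n,
      α k = -((((n - k : ℕ) : K))⁻¹
        • ∑ i ∈ Finset.Icc 1 (n - k), α (k + i) * (A ^ i).trace))
    (hβn : β n = 0)
    (hβ : ∀ k < n,
      β k = -((((n - k : ℕ) : K))⁻¹
        • ((∑ i ∈ Finset.Icc 1 (n - k), β (k + i) * (A ^ i).trace)
            + ∑ r ∈ Finset.range (n - k), ∑ s ∈ Finset.range (n - k - r),
                α (k + r + s + 1) * (A ^ r * B * A ^ s).trace))) :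
    β 0 • (1 : Matrix (Fin n) (Fin n) E)
      + ∑ k ∈ Finset.Icc 1 n,
          (β k • A ^ k
            + α k • ∑ r ∈ Finset.range k, A ^ r * B * A ^ (k - 1 - r)) = 0 := by
  have hψ1 : ψ 1 = 0 := by
    have := hψ 1 1
    simpa using this
  have hmulψ : ∀ X Y : Matrix (Fin n) (Fin n) S,
      (X * Y).map ψ = X.map φ * Y.map ψ + X.map ψ * Y.map φ := by
    intro X Y
    ext i j
    simp [Matrix.mul_apply, hψ, sum_add_distrib]
  have hφpow : ∀ k, (M ^ k).map φ = A ^ k := by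
    intro k
    have := map_pow (φ.mapMatrix (m := Fin n)) M k
    simpa [hA] using this
  have hψpow : ∀ k, (M ^ k).map ψ = ∑ r ∈ range k, A ^ r * B * A ^ (k - 1 - r) := by
    intro k
    induction k with
    | zero =>
      ext i j
      by_cases h : i = j
      · simp [h, hψ1]
      · simp [h]
    | succ k ih =>
      rw [pow_succ', hmulψ, ih, hA, hB, hφpow, sum_range_succ', mul_sum]
      congr 1
      · refine sum_congr rfl fun r hr => ?_
        rw [pow_succ' A r, show k + 1 - 1 - (r + 1) = k - 1 - r by omega]
        simp only [mul_assoc]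
      · simp
  have hφtr : ∀ X : Matrix (Fin n) (Fin n) S, φ X.trace = (X.map φ).trace := by
    intro X; simp [Matrix.trace]
  have hψtr : ∀ X : Matrix (Fin n) (Fin n) S, ψ X.trace = (X.map ψ).trace := by
    intro X; simp [Matrix.trace]
  have hcn : M.charpoly.coeff n = 1 := by
    nontriviality S
    have := (charpoly_monic M).coeff_natDegree
    simpa using this
  have hαeq : ∀ k ≤ n, α k = φ (M.charpoly.coeff k) := by
    apply desc_induction
    · rw [hαn, hcn, map_one]
    · intro k hk ih
      rw [hα k hk, newton_smul (K := K) M k hk, map_neg, map_smul, map_sum]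
      congr 2
      refine sum_congr rfl fun i hi => ?_
      rw [mem_Icc] at hi
      rw [ih (k+i) (by omega) (by omega), map_mul, hφtr, hφpow]
  have hβeq : ∀ k ≤ n, β k = ψ (M.charpoly.coeff k) := by
    apply desc_induction
    · rw [hβn, hcn, hψ1]
    · intro k hk ih
      rw [hβ k hk, newton_smul (K := K) M k hk, map_neg, map_smul, map_sum]
      congr 2
      simp only [hψ, hφtr, hψtr, hφpow, hψpow]
      rw [sum_add_distrib, add_comm]
      congr 1
      · have e1 : ∑ x ∈ Icc 1 (n - k), φ (M.charpoly.coeff (k + x)) *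
            (∑ r ∈ range x, A ^ r * B * A ^ (x - 1 - r)).trace
          = ∑ x ∈ range (n - k), ∑ r ∈ range (x + 1),
            α (k + x + 1) * (A ^ r * B * A ^ (x - r)).trace := by
          change ∑ x ∈ Ico (0 + 1) (n - k + 1), _ = _
          rw [range_eq_Ico, ← sum_Ico_add' _ 0 (n-k) 1]
          refine sum_congr rfl fun x hx => ?_
          rw [mem_Ico] at hx
          rw [trace_sum, mul_sum, ← add_assoc, hαeq _ (by omega)]
          rfl
        rw [e1]
        rw [sum_sigma', sum_sigma']
        refine sum_bij' (fun p _ => ⟨p.1 + p.2, p.1⟩) (fun p _ => ⟨p.2, p.1 - p.2⟩) ?_ ?_ ?_ ?_ ?_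
        · rintro ⟨r, s⟩ h; simp only [mem_sigma, mem_range] at h ⊢; omega
        · rintro ⟨r, s⟩ h; simp only [mem_sigma, mem_range] at h ⊢; omega
        · rintro ⟨r, s⟩ h; simp
        · rintro ⟨r, s⟩ h; simp only [mem_sigma, mem_range] at h
          simp only [Sigma.mk.injEq, heq_eq_eq, and_true]; omega
        · rintro ⟨r, s⟩ h; simp [add_assoc]
      · refine sum_congr rfl fun i hi => ?_
        rw [mem_Icc] at hi
        rw [ih (k+i) (by omega) (by omega)]
  have hCH := aeval_self_charpoly M
  have hCH' : ∑ k ∈ range (n+1), M.charpoly.coeff k • M ^ k = 0 := by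
    nontriviality S
    rw [← aeval_eq_sum_range' (n := n + 1) (by simp), hCH]
  have hfin : ∑ k ∈ range (n+1), (β k • A ^ k
            + α k • ∑ r ∈ Finset.range k, A ^ r * B * A ^ (k - 1 - r)) = 0 := by
    have h2 := congrArg (fun X : Matrix (Fin n) (Fin n) S => X.map ψ) hCH'
    ext i j
    have h3 := congrFun (congrFun h2 i) j
    simp only [Matrix.map_apply, Matrix.sum_apply, map_sum, Matrix.smul_apply, smul_eq_mul,
      hψ, Matrix.zero_apply, map_zero] at h3
    rw [Matrix.sum_apply, Matrix.zero_apply, ← h3]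
    refine sum_congr rfl fun k hk => ?_
    rw [mem_range] at hk
    rw [← hψpow, ← hφpow, hαeq k (by omega), hβeq k (by omega)]
    simp [add_comm]
  rw [← hfin, range_eq_Ico, sum_eq_sum_Ico_succ_bot (by omega)]
  simp
  rfl

lemma even_central {K V : Type*} [Field K] [AddCommGroup V] [Module K V]
    (x : ExteriorAlgebra K V)
    (hx : x ∈ CliffordAlgebra.evenOdd (0 : QuadraticForm K V) 0) (y : ExteriorAlgebra K V) :
    x * y = y * x := by
  have hsw : ∀ a b : V, ExteriorAlgebra.ι K a * ExteriorAlgebra.ι K b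
      = - (ExteriorAlgebra.ι K b * ExteriorAlgebra.ι K a) := fun a b =>
    eq_neg_of_add_eq_zero_left (ExteriorAlgebra.ι_add_mul_swap a b)
  induction x, hx using CliffordAlgebra.even_induction with
  | algebraMap r => exact Algebra.commutes r y
  | add x z hx hz h1 h2 => rw [add_mul, mul_add, h1, h2]
  | ι_mul_ι_mul a b x hx h =>
    change ExteriorAlgebra.ι K a * ExteriorAlgebra.ι K b * x * y
      = y * (ExteriorAlgebra.ι K a * ExteriorAlgebra.ι K b * x)
    have hab : ExteriorAlgebra.ι K a * ExteriorAlgebra.ι K b * y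
      = y * (ExteriorAlgebra.ι K a * ExteriorAlgebra.ι K b) := by
      clear h
      induction y using ExteriorAlgebra.induction with
      | algebraMap r => exact (Algebra.commutes r _).symm
      | ι c =>
        rw [mul_assoc, hsw b c, mul_neg, ← mul_assoc, hsw a c, neg_mul, neg_neg, mul_assoc]
      | mul u v hu hv => rw [← mul_assoc, hu, mul_assoc, hv, mul_assoc]
      | add u v hu hv => rw [mul_add, add_mul, hu, hv]
    rw [mul_assoc, h, ← mul_assoc, hab, mul_assoc]

/-- Elements of `E ⊕ εE` whose first component is central. -/
abbrev Sub (K E : Type*) [Field K] [Ring E] [Algebra K E] : Subalgebra K (TrivSqZeroExt E E) :=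
  (Subalgebra.center K E).comap (TrivSqZeroExt.fstHom K E E)

lemma sub_comm {K E : Type*} [Field K] [Ring E] [Algebra K E] (x y : Sub K E) :
    x * y = y * x := by
  obtain ⟨x, hx⟩ := x
  obtain ⟨y, hy⟩ := y
  have hx' : ∀ b, b * x.fst = x.fst * b := (Subalgebra.mem_center_iff (R := K)).mp hx
  have hy' : ∀ b, b * y.fst = y.fst * b := (Subalgebra.mem_center_iff (R := K)).mp hy
  apply Subtype.ext
  change x * y = y * x
  ext
  · simp [hx']
  · simp [hx', hy', add_comm]

/-- Commutative ring structure. -/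
noncomputable instance subCommRing (K E : Type*) [Field K] [Ring E] [Algebra K E] :
    CommRing (Sub K E) :=
  { (inferInstance : Ring (Sub K E)) with mul_comm := sub_comm }

end GCH

/-- Graded Cayley–Hamilton trace identity in `Mₙ(E)`: for `A ∈ Mₙ(E₀)`, `B ∈ Mₙ(E₁)`,
with `α₀,…,αₙ` the coefficients of the characteristic polynomial of `A` (characterized,
since the entries of `A` are even hence central and commute, by `αₙ = 1` together with the
Faddeev–LeVerrier recursion) and `β₀,…,βₙ` defined by `βₙ = 0` and the descending
recursion, we have
`β₀·Iₙ + ∑_{k=1}^{n} (βₖ·Aᵏ + αₖ·∑_{r+s=k−1} A^r B A^s) = 0`. -/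
theorem grassmann_graded_CH
    {K : Type*} [Field K] [CharZero K] {n : ℕ}
    (A B : Matrix (Fin n) (Fin n) (ExteriorAlgebra K (ℕ →₀ K)))
    (hA : ∀ i j, A i j ∈ CliffordAlgebra.evenOdd (0 : QuadraticForm K (ℕ →₀ K)) 0)
    (hB : ∀ i j, B i j ∈ CliffordAlgebra.evenOdd (0 : QuadraticForm K (ℕ →₀ K)) 1)
    (α β : ℕ → ExteriorAlgebra K (ℕ →₀ K))
    (hαn : α n = 1)
    (hα : ∀ k < n,
      α k = -((((n - k : ℕ) : K))⁻¹
        • ∑ i ∈ Finset.Icc 1 (n - k), α (k + i) * (A ^ i).trace))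
    (hβn : β n = 0)
    (hβ : ∀ k < n,
      β k = -((((n - k : ℕ) : K))⁻¹
        • ((∑ i ∈ Finset.Icc 1 (n - k), β (k + i) * (A ^ i).trace)
            + ∑ r ∈ Finset.range (n - k), ∑ s ∈ Finset.range (n - k - r),
                α (k + r + s + 1) * (A ^ r * B * A ^ s).trace))) :
    β 0 • (1 : Matrix (Fin n) (Fin n) (ExteriorAlgebra K (ℕ →₀ K)))
      + ∑ k ∈ Finset.Icc 1 n,
          (β k • A ^ k
            + α k • ∑ r ∈ Finset.range k, A ^ r * B * A ^ (k - 1 - r)) = 0 := by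
  have hc : ∀ i j (y : ExteriorAlgebra K (ℕ →₀ K)), A i j * y = y * A i j := fun i j y =>
    GCH.even_central _ (hA i j) y
  let M : Matrix (Fin n) (Fin n) (GCH.Sub K (ExteriorAlgebra K (ℕ →₀ K))) := fun i j =>
    ⟨TrivSqZeroExt.inl (A i j) + TrivSqZeroExt.inr (B i j), by
      change TrivSqZeroExt.fst _ ∈ Subalgebra.center K (ExteriorAlgebra K (ℕ →₀ K))
      rw [Subalgebra.mem_center_iff]
      intro b
      simp [hc i j b]⟩
  let φ : GCH.Sub K (ExteriorAlgebra K (ℕ →₀ K)) →ₐ[K] ExteriorAlgebra K (ℕ →₀ K) :=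
    (TrivSqZeroExt.fstHom K _ _).comp (Subalgebra.val _)
  let ψ : GCH.Sub K (ExteriorAlgebra K (ℕ →₀ K)) →ₗ[K] ExteriorAlgebra K (ℕ →₀ K) :=
    { toFun := fun x => x.1.snd
      map_add' := fun x y => rfl
      map_smul' := fun c x => rfl }
  refine GCH.main_aux φ ψ ?_ M A B ?_ ?_ α β hαn hα hβn hβ
  · intro x y
    change (x.1 * y.1).snd = x.1.fst * y.1.snd + x.1.snd * y.1.fst
    simp
  · ext i j
    change (TrivSqZeroExt.inl (A i j) + TrivSqZeroExt.inr (B i j)).fst = _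
    simp
  · ext i j
    change (TrivSqZeroExt.inl (A i j) + TrivSqZeroExt.inr (B i j)).snd = _
    simp
end

section
/- Let E be the infinite-dimensional Grassmann algebra over a field K of characteristic zero and B ∈ Mₙ(E₁). Let γ₀,...,γₙ ∈ E₀ be the coefficients of the characteristic polynomial of B² ∈ Mₙ(E₀): det(xI − B²) = ∑ₖ γₖxᵏ, γₙ = 1, and define δ₀,...,δₙ ∈ E₁ by δₙ = 0 and δₖ = −(1/(n−k))·( ∑_{i=1}^{n−k} δ_{k+i}·tr(B^{2i}) + ∑_{r+s ≤ n−k−1, r,s ≥ 0} γ_{k+r+s+1}·tr(B^{2r+2s+1}) ) for 0 ≤ k ≤ n−1. Then δ₀·Iₙ + ∑_{k=1}^{n} ( k·γₖ·B^{2k−1} + δₖ·B^{2k} ) = 0; in particular this is a monic (leading coefficient n) trace identity for B of degree 2n−1. -/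
open Matrix

section OddCH
open Polynomial

theorem oddCH_derivative_charpoly {R : Type*} [CommRing R] {n : ℕ} (M : Matrix (Fin n) (Fin n) R) :
    derivative M.charpoly = (adjugate (charmatrix M)).trace := by
  have h : ∀ (A : Matrix (Fin n) (Fin n) R[X]),
      derivative A.det = ∑ i, (A.updateCol i (fun j => derivative (A j i))).det := by
    intro A
    simp only [det_apply, derivative_sum]
    rw [Finset.sum_comm]
    refine Finset.sum_congr rfl fun σ _ => ?_
    rw [← Finset.smul_sum, Units.smul_def, Units.smul_def, derivative_smul,
      derivative_prod_finset]
    congr 1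
    refine Finset.sum_congr rfl fun i _ => ?_
    rw [← Finset.prod_erase_mul _ _ (Finset.mem_univ i)]
    congr 1
    · refine Finset.prod_congr rfl fun j hj => ?_
      rw [updateCol_ne (Finset.ne_of_mem_erase hj)]
    · rw [updateCol_self]
  rw [charpoly, h, trace]
  refine Finset.sum_congr rfl fun i _ => ?_
  have hadj : (charmatrix M).adjugate i i = (charmatrix M)ᵀ.adjugate i i := by
    rw [← adjugate_transpose, transpose_apply]
  rw [diag_apply, hadj, adjugate_apply, updateRow_transpose, det_transpose]
  congr 2
  funext j
  by_cases hj : j = i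
  · subst hj; simp [charmatrix_apply_eq]
  · simp [charmatrix_apply_ne _ _ _ hj, Pi.single_apply, hj]

theorem oddCH_newton {R : Type*} [CommRing R] {n : ℕ} (M : Matrix (Fin n) (Fin n) R) (k : ℕ)
    (hk : k ≤ n) :
    (k : R) * M.charpoly.coeff k =
      ∑ i ∈ Finset.range (n - k + 1), M.charpoly.coeff (k + i) * (M ^ i).trace := by
  nontriviality R
  have hdeg : M.charpoly.natDegree = n := by simpa using M.charpoly_natDegree_eq_dim
  obtain _ | k := k
  · have h := congrArg trace (aeval_self_charpoly M)
    rw [aeval_eq_sum_range, hdeg, trace_sum] at h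
    simpa [trace_smul] using h.symm
  set N := matPolyEquiv (adjugate (charmatrix M)) with hN
  have hmul : N * (X - C M) = M.charpoly.map (algebraMap R (Matrix (Fin n) (Fin n) R)) := by
    rw [← matPolyEquiv_charmatrix, hN, ← map_mul, adjugate_mul, ← matPolyEquiv_smul_one]
    rfl
  have hrec : ∀ k, N.coeff k = M.charpoly.coeff (k + 1) • 1 + N.coeff (k + 1) * M := by
    intro k
    have := congrArg (fun p => p.coeff (k + 1)) hmul
    simp only [mul_sub, coeff_sub, coeff_mul_X, coeff_mul_C, coeff_map,
      Algebra.algebraMap_eq_smul_one] at this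
    rw [← this]; abel
  have htr : ∀ k, (N.coeff k).trace = ((k + 1 : ℕ) : R) * M.charpoly.coeff (k + 1) := by
    intro k
    have := congrArg (fun p => p.coeff k) (oddCH_derivative_charpoly M)
    simp only [coeff_derivative, trace, diag_apply, finsetSum_coeff] at this
    simp only [trace, diag_apply, hN, matPolyEquiv_coeff_apply]
    rw [← this]; push_cast; ring
  have hit : ∀ m, (N.coeff k).trace =
      ∑ i ∈ Finset.range m, M.charpoly.coeff (k + 1 + i) * (M ^ i).trace
        + (N.coeff (k + m) * M ^ m).trace := by
    intro m
    induction m with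
    | zero => simp
    | succ m ih =>
      rw [ih, Finset.sum_range_succ, hrec (k + m), add_mul, trace_add, mul_assoc, ← pow_succ',
        smul_one_mul, trace_smul, smul_eq_mul, add_assoc (∑ i ∈ _, _)]
      congr 3
      · congr 1; omega
  rw [← htr, hit (n - (k + 1) + 1 + N.natDegree + 1), coeff_eq_zero_of_natDegree_lt (p := N) (by omega)]
  simp only [zero_mul, trace_zero, add_zero]
  symm
  refine Finset.sum_subset (fun i hi => ?_) (fun i _ hi => ?_)
  · simp only [Finset.mem_range] at *; omega
  · rw [coeff_eq_zero_of_natDegree_lt, zero_mul]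
    simp only [Finset.mem_range] at *; omega

theorem oddCH_comm {R : Type*} [CommRing R] (htf : ∀ (m : ℕ) (x : R), m ≠ 0 → m • x = 0 → x = 0)
    {n : ℕ} (M : Matrix (Fin n) (Fin n) R) (c : ℕ → R) (hn : c n = 1)
    (hc : ∀ k < n, (n - k) • c k = -∑ i ∈ Finset.Icc 1 (n - k), c (k + i) * (M ^ i).trace) :
    ∑ k ∈ Finset.range (n + 1), c k • M ^ k = 0 := by
  nontriviality R
  have hdeg : M.charpoly.natDegree = n := by simpa using M.charpoly_natDegree_eq_dim
  have key : ∀ d ≤ n, c (n - d) = M.charpoly.coeff (n - d) := by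
    intro d
    induction d using Nat.strong_induction_on with
    | _ d ih =>
    intro hd
    obtain rfl | hd0 := Nat.eq_zero_or_pos d
    · have := M.charpoly_monic.coeff_natDegree
      rw [hdeg] at this
      simp [hn, this]
    · have h1 := hc (n - d) (by omega)
      have h2 := oddCH_newton M (n - d) (by omega)
      have e : n - (n - d) = d := by omega
      rw [e] at h1 h2
      rw [Finset.sum_range_succ'] at h2
      have h3 : ∑ i ∈ Finset.Icc 1 d, c (n - d + i) * (M ^ i).trace =
          ∑ i ∈ Finset.range d, M.charpoly.coeff (n - d + (i + 1)) * (M ^ (i + 1)).trace := by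
        rw [← Finset.Ico_add_one_right_eq_Icc, Finset.sum_Ico_eq_sum_range]
        refine Finset.sum_congr (by simp) fun i hi => ?_
        simp only [Finset.mem_range] at hi
        have := ih (d - (i + 1)) (by omega) (by omega)
        rw [show n - (d - (i + 1)) = n - d + (i + 1) by omega] at this
        rw [add_comm 1 i, this]
      rw [h3] at h1
      simp only [pow_zero, trace_one, Fintype.card_fin, add_zero] at h2
      rw [← sub_eq_zero]
      refine htf d _ (by omega) ?_
      rw [smul_sub, h1, nsmul_eq_mul]
      rw [Nat.cast_sub hd] at h2
      linear_combination h2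
  have h := aeval_self_charpoly M
  rw [aeval_eq_sum_range, hdeg] at h
  rw [← h]
  refine Finset.sum_congr rfl fun k hk => ?_
  simp only [Finset.mem_range] at hk
  have := key (n - k) (by omega)
  rw [show n - (n - k) = k by omega] at this
  rw [this]

/-- Dual numbers with central first component. -/
def oddCHRing (E : Type*) [Ring E] : Subring (TrivSqZeroExt E E) :=
  (Subring.center E).comap (TrivSqZeroExt.fstHom ℤ E E).toRingHom

theorem oddCH_mem {E : Type*} [Ring E] {x : TrivSqZeroExt E E} :
    x ∈ oddCHRing E ↔ x.fst ∈ Subring.center E := Iff.rfl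

noncomputable instance oddCHCommRing (E : Type*) [Ring E] : CommRing (oddCHRing E) :=
  { (oddCHRing E).toRing with
    mul_comm := by
      rintro ⟨x, hx⟩ ⟨y, hy⟩
      rw [oddCH_mem, Subring.mem_center_iff] at hx hy
      apply Subtype.ext
      apply TrivSqZeroExt.ext
      · simp [hx]
      · simp [hx, hy, add_comm] }

theorem oddCH_core {E : Type*} [Ring E] (htf : ∀ (m : ℕ) (x : E), m ≠ 0 → m • x = 0 → x = 0)
    {n : ℕ} (B : Matrix (Fin n) (Fin n) E) (hB : ∀ i j, (B ^ 2) i j ∈ Subring.center E)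
    (γ δ : ℕ → E) (hγn : γ n = 1)
    (hγ : ∀ k < n, (n - k) • γ k = -∑ i ∈ Finset.Icc 1 (n - k), γ (k + i) * (B ^ (2 * i)).trace)
    (hδn : δ n = 0)
    (hδ : ∀ k < n, (n - k) • δ k = -∑ i ∈ Finset.Icc 1 (n - k), (δ (k + i) * (B ^ (2 * i)).trace
      + i • (γ (k + i) * (B ^ (2 * i - 1)).trace))) :
    ∑ k ∈ Finset.range (n + 1), (k • (γ k • B ^ (2 * k - 1)) + δ k • B ^ (2 * k)) = 0 := by
  let A : Matrix (Fin n) (Fin n) (oddCHRing E) := fun i j =>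
    ⟨TrivSqZeroExt.inl ((B ^ 2) i j) + TrivSqZeroExt.inr (B i j), by
      rw [oddCH_mem]; simpa using hB i j⟩
  have hsumfst : ∀ (s : Finset (Fin n)) (f : Fin n → oddCHRing E),
      ((∑ i ∈ s, f i : oddCHRing E) : TrivSqZeroExt E E).fst = ∑ i ∈ s, (f i : TrivSqZeroExt E E).fst := by
    intro s f; rw [AddSubmonoidClass.coe_finsetSum, TrivSqZeroExt.fst_sum]
  have hsumsnd : ∀ (s : Finset (Fin n)) (f : Fin n → oddCHRing E),
      ((∑ i ∈ s, f i : oddCHRing E) : TrivSqZeroExt E E).snd = ∑ i ∈ s, (f i : TrivSqZeroExt E E).snd := by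
    intro s f; rw [AddSubmonoidClass.coe_finsetSum, TrivSqZeroExt.snd_sum]
  have hfst : ∀ k i j, ((A ^ k) i j : TrivSqZeroExt E E).fst = (B ^ (2 * k)) i j := by
    intro k
    induction k with
    | zero =>
      intro i j
      by_cases h : i = j <;> simp [Matrix.one_apply, h]
    | succ k ih =>
      intro i j
      rw [pow_succ, mul_apply, hsumfst, show 2 * (k + 1) = 2 * k + 2 by ring, pow_add, mul_apply]
      refine Finset.sum_congr rfl fun l _ => ?_
      rw [Subring.coe_mul, TrivSqZeroExt.fst_mul, ih]
      simp [A]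
  have hsnd : ∀ k i j, ((A ^ k) i j : TrivSqZeroExt E E).snd = k • (B ^ (2 * k - 1)) i j := by
    intro k
    induction k with
    | zero =>
      intro i j
      by_cases h : i = j <;> simp [Matrix.one_apply, h]
    | succ k ih =>
      intro i j
      have h1 : (B ^ (2 * (k + 1) - 1)) i j = ∑ l, (B ^ (2 * k)) i l * B l j := by
        rw [show 2 * (k + 1) - 1 = 2 * k + 1 by omega, pow_succ, mul_apply]
      have h2 : k • (B ^ (2 * (k + 1) - 1)) i j = ∑ l, (k • (B ^ (2 * k - 1)) i l) * (B ^ 2) l j := by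
        obtain rfl | hk := Nat.eq_zero_or_pos k
        · simp
        rw [show 2 * (k + 1) - 1 = 2 * k - 1 + 2 by omega, pow_add, mul_apply, Finset.smul_sum]
        simp only [smul_mul_assoc]
      rw [succ_nsmul, h2, h1, pow_succ, mul_apply, hsumsnd, ← Finset.sum_add_distrib]
      refine Finset.sum_congr rfl fun l _ => ?_
      rw [Subring.coe_mul, TrivSqZeroExt.snd_mul, ih, hfst]
      simp [A, add_comm]
  have htrfst : ∀ k, ((A ^ k).trace : TrivSqZeroExt E E).fst = (B ^ (2 * k)).trace := by
    intro k
    simp only [trace, diag_apply, hsumfst, hfst]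
  have htrsnd : ∀ k, ((A ^ k).trace : TrivSqZeroExt E E).snd = k • (B ^ (2 * k - 1)).trace := by
    intro k
    simp only [trace, diag_apply, hsumsnd, hsnd, Finset.smul_sum]
  have hcen : ∀ k, (B ^ (2 * k)).trace ∈ Subring.center E := by
    intro k
    rw [← htrfst]
    exact (A ^ k).trace.2
  have hγc : ∀ d ≤ n, γ (n - d) ∈ Subring.center E := by
    intro d
    induction d using Nat.strong_induction_on with
    | _ d ih =>
    intro hd
    obtain rfl | hd0 := Nat.eq_zero_or_pos d
    · simp [hγn, one_mem]
    · have h1 := hγ (n - d) (by omega)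
      rw [show n - (n - d) = d by omega] at h1
      have h2 : d • γ (n - d) ∈ Subring.center E := by
        rw [h1]
        refine neg_mem (sum_mem fun i hi => mul_mem ?_ (hcen i))
        simp only [Finset.mem_Icc] at hi
        rw [show n - d + i = n - (d - i) by omega]
        exact ih _ (by omega) (by omega)
      rw [Subring.mem_center_iff] at h2 ⊢
      intro g
      rw [← sub_eq_zero]
      refine htf d _ (by omega) ?_
      rw [smul_sub, ← mul_smul_comm, ← smul_mul_assoc, h2, sub_self]
  let c : ℕ → oddCHRing E := fun k => if h : k ≤ n then
    ⟨TrivSqZeroExt.inl (γ k) + TrivSqZeroExt.inr (δ k), by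
      rw [oddCH_mem]
      have := hγc (n - k) (by omega)
      rw [show n - (n - k) = k by omega] at this
      simpa using this⟩ else 0
  have hcf : ∀ k ≤ n, (c k : TrivSqZeroExt E E).fst = γ k := by
    intro k hk; simp [c, hk]
  have hcs : ∀ k ≤ n, (c k : TrivSqZeroExt E E).snd = δ k := by
    intro k hk; simp [c, hk]
  have main := oddCH_comm (R := oddCHRing E) ?_ A c ?_ ?_
  · ext i j
    have := congrArg (fun X : Matrix (Fin n) (Fin n) (oddCHRing E) =>
      (X i j : TrivSqZeroExt E E).snd) main
    simp only [Matrix.sum_apply, AddSubmonoidClass.coe_finsetSum, TrivSqZeroExt.snd_sum] at this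
    rw [Matrix.sum_apply]
    refine Eq.trans (Finset.sum_congr rfl fun k hk => ?_) this
    simp only [Finset.mem_range] at hk
    rw [Matrix.smul_apply, smul_eq_mul, Subring.coe_mul, TrivSqZeroExt.snd_mul, hfst, hsnd,
      hcf k (by omega), hcs k (by omega), Matrix.add_apply, Matrix.smul_apply, Matrix.smul_apply,
      Matrix.smul_apply, smul_eq_mul, smul_eq_mul, smul_eq_mul, mul_smul_comm,
      op_smul_eq_mul]
  · intro m x hm hx
    have h1 := congrArg (fun y : oddCHRing E => (y : TrivSqZeroExt E E).fst) hx
    have h2 := congrArg (fun y : oddCHRing E => (y : TrivSqZeroExt E E).snd) hx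
    apply Subtype.ext
    apply TrivSqZeroExt.ext
    · exact htf m _ hm (by simpa using h1)
    · exact htf m _ hm (by simpa using h2)
  · apply Subtype.ext
    apply TrivSqZeroExt.ext
    · rw [hcf n le_rfl, hγn]; simp
    · rw [hcs n le_rfl, hδn]; simp
  · intro k hk
    apply Subtype.ext
    apply TrivSqZeroExt.ext
    · simp only [AddSubmonoidClass.coe_nsmul, TrivSqZeroExt.fst_smul, hcf k hk.le, hγ k hk,
        NegMemClass.coe_neg, TrivSqZeroExt.fst_neg, AddSubmonoidClass.coe_finsetSum,
        TrivSqZeroExt.fst_sum]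
      congr 1
      refine Finset.sum_congr rfl fun i hi => ?_
      simp only [Finset.mem_Icc] at hi
      rw [Subring.coe_mul, TrivSqZeroExt.fst_mul, hcf _ (by omega), htrfst]
    · simp only [AddSubmonoidClass.coe_nsmul, TrivSqZeroExt.snd_smul, hcs k hk.le, hδ k hk,
        NegMemClass.coe_neg, TrivSqZeroExt.snd_neg, AddSubmonoidClass.coe_finsetSum,
        TrivSqZeroExt.snd_sum]
      congr 1
      refine Finset.sum_congr rfl fun i hi => ?_
      simp only [Finset.mem_Icc] at hi
      rw [Subring.coe_mul, TrivSqZeroExt.snd_mul, hcf _ (by omega), hcs _ (by omega), htrfst,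
        htrsnd, smul_eq_mul, mul_smul_comm, op_smul_eq_mul, add_comm]

theorem oddCH_even_central {K M : Type*} [Field K] [AddCommGroup M] [Module K M]
    (x : ExteriorAlgebra K M) (hx : x ∈ CliffordAlgebra.evenOdd (0 : QuadraticForm K M) 0) :
    x ∈ Subring.center (ExteriorAlgebra K M) := by
  induction x, hx using CliffordAlgebra.even_induction with
  | algebraMap r =>
    rw [Subring.mem_center_iff]
    intro g
    exact (Algebra.commutes r g).symm
  | add x y hx hy ihx ihy => exact add_mem ihx ihy
  | ι_mul_ι_mul m₁ m₂ x hx ih =>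
    refine mul_mem ?_ ih
    have anti : ∀ a b : M, ExteriorAlgebra.ι K a * ExteriorAlgebra.ι K b
        = -(ExteriorAlgebra.ι K b * ExteriorAlgebra.ι K a) := fun a b =>
      eq_neg_of_add_eq_zero_left (ExteriorAlgebra.ι_add_mul_swap a b)
    rw [Subring.mem_center_iff]
    intro g
    change g * (ExteriorAlgebra.ι K m₁ * ExteriorAlgebra.ι K m₂)
      = (ExteriorAlgebra.ι K m₁ * ExteriorAlgebra.ι K m₂) * g
    induction g using ExteriorAlgebra.induction with
    | algebraMap r => exact Algebra.commutes r _
    | ι v =>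
      rw [← mul_assoc, anti v m₁, mul_assoc _ _ (ExteriorAlgebra.ι K v), anti m₂ v, neg_mul,
        mul_neg, mul_assoc]
    | mul a b ha hb => rw [mul_assoc, hb, ← mul_assoc, ha, mul_assoc]
    | add a b ha hb => rw [add_mul, mul_add, ha, hb]

end OddCH

/-- The odd Cayley–Hamilton trace identity of degree `2n−1`: for `B ∈ Mₙ(E₁)`, with
`γ₀,…,γₙ` the coefficients of the characteristic polynomial of `B² ∈ Mₙ(E₀)`
(characterized by `γₙ = 1` and the Faddeev–LeVerrier recursion, valid since the entries of
`B²` are even hence central) and `δ₀,…,δₙ` defined by `δₙ = 0` and the descending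
recursion, we have `δ₀·Iₙ + ∑_{k=1}^{n} (k·γₖ·B^{2k−1} + δₖ·B^{2k}) = 0`; note the
leading term is `n·γₙ·B^{2n−1} = n·B^{2n−1}`, so this is a monic trace identity of degree
`2n−1` for `B`. -/
theorem grassmann_odd_CH
    {K : Type*} [Field K] [CharZero K] {n : ℕ}
    (B : Matrix (Fin n) (Fin n) (ExteriorAlgebra K (ℕ →₀ K)))
    (hB : ∀ i j, B i j ∈ CliffordAlgebra.evenOdd (0 : QuadraticForm K (ℕ →₀ K)) 1)
    (γ δ : ℕ → ExteriorAlgebra K (ℕ →₀ K))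
    (hγn : γ n = 1)
    (hγ : ∀ k < n,
      γ k = -((((n - k : ℕ) : K))⁻¹
        • ∑ i ∈ Finset.Icc 1 (n - k), γ (k + i) * (B ^ (2 * i)).trace))
    (hδn : δ n = 0)
    (hδ : ∀ k < n,
      δ k = -((((n - k : ℕ) : K))⁻¹
        • ((∑ i ∈ Finset.Icc 1 (n - k), δ (k + i) * (B ^ (2 * i)).trace)
            + ∑ r ∈ Finset.range (n - k), ∑ s ∈ Finset.range (n - k - r),
                γ (k + r + s + 1) * (B ^ (2 * r + 2 * s + 1)).trace))) :
    δ 0 • (1 : Matrix (Fin n) (Fin n) (ExteriorAlgebra K (ℕ →₀ K)))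
      + ∑ k ∈ Finset.Icc 1 n,
          (k • (γ k • B ^ (2 * k - 1)) + δ k • B ^ (2 * k)) = 0 := by
  have htf : ∀ (m : ℕ) (x : ExteriorAlgebra K (ℕ →₀ K)), m ≠ 0 → m • x = 0 → x = 0 := by
    intro m x hm hx
    rw [← Nat.cast_smul_eq_nsmul K] at hx
    exact (smul_eq_zero.mp hx).resolve_left (Nat.cast_ne_zero.mpr hm)
  have hcancel : ∀ k < n, ∀ x : ExteriorAlgebra K (ℕ →₀ K),
      (n - k) • -((((n - k : ℕ) : K))⁻¹ • x) = -x := by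
    intro k hk x
    rw [smul_neg, ← Nat.cast_smul_eq_nsmul K, smul_smul, mul_inv_cancel₀, one_smul]
    exact Nat.cast_ne_zero.mpr (by omega)
  have hdouble : ∀ (m : ℕ) (f : ℕ → ExteriorAlgebra K (ℕ →₀ K)),
      ∑ r ∈ Finset.range m, ∑ s ∈ Finset.range (m - r), f (r + s)
        = ∑ i ∈ Finset.range m, (i + 1) • f i := by
    intro m f
    induction m with
    | zero => simp
    | succ m ih =>
      rw [Finset.sum_range_succ (fun i => (i + 1) • f i) m, ← ih, Finset.sum_range_succ _ m]
      have h : ∀ r ∈ Finset.range m, ∑ s ∈ Finset.range (m + 1 - r), f (r + s)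
          = ∑ s ∈ Finset.range (m - r), f (r + s) + f m := by
        intro r hr
        simp only [Finset.mem_range] at hr
        rw [show m + 1 - r = m - r + 1 by omega, Finset.sum_range_succ,
          show r + (m - r) = m by omega]
      rw [Finset.sum_congr rfl h, Finset.sum_add_distrib]
      simp [add_assoc, add_mul]
  have core := oddCH_core htf B ?_ γ δ hγn ?_ hδn ?_
  · rw [Finset.range_eq_Ico, Finset.sum_eq_sum_Ico_succ_bot (by omega)] at core
    rw [← Finset.Ico_add_one_right_eq_Icc, ← core]
    simp
  · intro i j
    apply oddCH_even_central
    rw [pow_two, mul_apply]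
    refine sum_mem fun l _ => ?_
    exact CliffordAlgebra.evenOdd_mul_le (0 : QuadraticForm K (ℕ →₀ K)) 1 1
      (Submodule.mul_mem_mul (hB i l) (hB l j))
  · intro k hk
    rw [hγ k hk, hcancel k hk]
  · intro k hk
    rw [hδ k hk, hcancel k hk, Finset.sum_add_distrib]
    congr 2
    have := hdouble (n - k) (fun i => γ (k + i + 1) * (B ^ (2 * i + 1)).trace)
    rw [← Finset.Ico_add_one_right_eq_Icc, Finset.sum_Ico_eq_sum_range]
    refine Eq.trans (Eq.trans ?_ this) ?_
    · refine Finset.sum_congr rfl fun r _ => Finset.sum_congr rfl fun s _ => ?_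
      rw [← add_assoc k r s, mul_add]
    · refine Finset.sum_congr (by simp) fun i _ => ?_
      rw [add_comm 1 i, show 2 * (i + 1) - 1 = 2 * i + 1 by omega, add_assoc]
end

section
/- Let E = E₀ ⊕ E₁ be the infinite-dimensional Grassmann algebra over a field of characteristic zero and let B ∈ Mₙ(E₁) with 2 ≤ n. If tr(Bᵗ) = 0 for all 1 ≤ t ≤ 2n−1, then B^{2n−1} = 0. -/
open Matrix

namespace GrassmannAux

open Polynomial in
/-- Jacobi's formula for the characteristic polynomial. -/
theorem derivative_charpoly {R : Type*} [CommRing R] {n : ℕ} (M : Matrix (Fin n) (Fin n) R) :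
    derivative M.charpoly = (adjugate (charmatrix M)).trace := by
  have hdet : ∀ A : Matrix (Fin n) (Fin n) R[X],
      A.det = ∑ σ : Equiv.Perm (Fin n), ((Equiv.Perm.sign σ : ℤ) : R[X]) * ∏ i, A i (σ i) := by
    intro A
    rw [← det_transpose, det_apply']
    rfl
  simp only [Matrix.trace, diag_apply, adjugate_apply]
  rw [charpoly, hdet, derivative_sum]
  simp_rw [hdet]
  rw [Finset.sum_comm]
  refine Finset.sum_congr rfl fun σ _ => ?_
  rw [derivative_mul, derivative_intCast, zero_mul, zero_add, derivative_prod_finset,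
    Finset.mul_sum]
  refine Finset.sum_congr rfl fun k _ => ?_
  congr 1
  rw [← Finset.prod_erase_mul _ _ (Finset.mem_univ k)]
  congr 1
  · refine Finset.prod_congr rfl fun i hi => ?_
    rw [updateRow_ne (Finset.ne_of_mem_erase hi)]
  · rw [updateRow_self, charmatrix_apply, diagonal_apply, Pi.single_apply]
    by_cases h : k = σ k
    · rw [if_pos h, if_pos h.symm]; simp
    · rw [if_neg h, if_neg (Ne.symm h)]; simp

open Polynomial in
/-- Over a torsion-free commutative ring, vanishing power traces force nilpotency. -/
theorem pow_eq_zero_of_trace {R : Type*} [CommRing R]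
    (htf : ∀ (k : ℕ) (x : R), ((k + 1 : ℕ) : R) * x = 0 → x = 0)
    {m : ℕ} (M : Matrix (Fin (m + 1)) (Fin (m + 1)) R)
    (htr : ∀ k, 1 ≤ k → k ≤ m + 1 → (M ^ k).trace = 0) : M ^ (m + 1) = 0 := by
  nontriviality R
  set A := adjugate (charmatrix M) with hA
  set N : ℕ → Matrix (Fin (m + 1)) (Fin (m + 1)) R := fun j => A.map fun p => p.coeff j with hN
  have hmul : charmatrix M * A = M.charpoly • (1 : Matrix _ _ R[X]) := mul_adjugate _
  have hent : ∀ i j, X * A i j - ∑ l, C (M i l) * A l j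
      = M.charpoly * (1 : Matrix (Fin (m + 1)) (Fin (m + 1)) R[X]) i j := by
    intro i j
    have := congrFun (congrFun hmul i) j
    rw [Matrix.mul_apply] at this
    simp only [charmatrix_apply, sub_mul, Finset.sum_sub_distrib, diagonal_apply, ite_mul,
      zero_mul, Finset.sum_ite_eq, Finset.mem_univ, if_true] at this
    rw [this]; rfl
  have hrec : ∀ j, N j = M * N (j + 1) + M.charpoly.coeff (j + 1) • (1 : Matrix _ _ R) := by
    intro d
    ext i j
    have := congrArg (fun p => p.coeff (d + 1)) (hent i j)
    simp only [coeff_sub, coeff_X_mul, finsetSum_coeff, coeff_C_mul] at this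
    simp only [hN, Matrix.add_apply, Matrix.mul_apply, map_apply, Matrix.smul_apply, smul_eq_mul]
    rw [sub_eq_iff_eq_add'] at this
    rw [this]
    congr 1
    by_cases h : i = j
    · subst h; simp
    · simp [Matrix.one_apply_ne h]
  have hzero : M * N 0 + M.charpoly.coeff 0 • (1 : Matrix _ _ R) = 0 := by
    ext i j
    have := congrArg (fun p => p.coeff 0) (hent i j)
    simp only [coeff_sub, finsetSum_coeff, coeff_C_mul, mul_coeff_zero, coeff_X_zero,
      zero_mul, zero_sub] at this
    simp only [hN, Matrix.add_apply, Matrix.mul_apply, map_apply, Matrix.smul_apply, smul_eq_mul]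
    have h2 : (coeff ((1 : Matrix (Fin (m + 1)) (Fin (m + 1)) R[X]) i j) 0)
        = (1 : Matrix (Fin (m + 1)) (Fin (m + 1)) R) i j := by
      by_cases h : i = j
      · subst h; simp
      · simp [Matrix.one_apply_ne h]
    rw [h2] at this
    rw [← this]
    simp
  have htrN : ∀ j, (N j).trace = M.charpoly.coeff (j + 1) * (j + 1 : ℕ) := by
    intro j
    have := congrArg (fun p => p.coeff j) (derivative_charpoly M)
    simp only [coeff_derivative] at this
    push_cast
    rw [this, Matrix.trace, Matrix.trace, finsetSum_coeff]
    rfl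
  have hdeg : M.charpoly.natDegree = m + 1 := by simp
  have htop : M.charpoly.coeff (m + 1) = 1 := by
    have := M.charpoly_monic.coeff_natDegree
    rwa [hdeg] at this
  have hNm : N (m + 1) = 0 := by
    obtain ⟨D, hD⟩ : ∃ D, ∀ d, D ≤ d → N d = 0 := by
      refine ⟨(∑ i, ∑ j, (A i j).natDegree) + 1, fun d hd => ?_⟩
      ext i j
      simp only [hN, map_apply, Matrix.zero_apply]
      apply coeff_eq_zero_of_natDegree_lt
      have h1 : (A i j).natDegree ≤ ∑ j, (A i j).natDegree :=
        Finset.single_le_sum (f := fun j => (A i j).natDegree) (fun _ _ => Nat.zero_le _)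
          (Finset.mem_univ j)
      have h2 : ∑ j, (A i j).natDegree ≤ ∑ i, ∑ j, (A i j).natDegree :=
        Finset.single_le_sum (f := fun i => ∑ j, (A i j).natDegree) (fun _ _ => Nat.zero_le _)
          (Finset.mem_univ i)
      omega
    have hdown : ∀ e d, m + 1 ≤ d → D ≤ d + e → N d = 0 := by
      intro e
      induction e with
      | zero => intro d _ h; exact hD d h
      | succ e ih =>
        intro d h1 h2
        rw [hrec, ih (d + 1) (by omega) (by omega),
          coeff_eq_zero_of_natDegree_lt (by rw [hdeg]; omega)]
        simp
    exact hdown D (m + 1) le_rfl (by omega)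
  have key : ∀ k, k ≤ m → N (m - k) = M ^ k := by
    intro k
    induction k with
    | zero => intro _; rw [Nat.sub_zero, hrec, hNm, htop]; simp
    | succ k ih =>
      intro hk
      have e : m - (k + 1) + 1 = m - k := by omega
      have h1 := hrec (m - (k + 1))
      have h2 := htrN (m - (k + 1))
      rw [e, ih (by omega), ← pow_succ'] at h1
      rw [e] at h2
      have hc : M.charpoly.coeff (m - k) = 0 := by
        apply htf k
        rw [h1, trace_add, htr _ (by omega) (by omega), trace_smul, trace_one, Fintype.card_fin,
          smul_eq_mul, zero_add, ← sub_eq_zero, ← mul_sub, ← Nat.cast_sub (by omega)] at h2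
        rw [mul_comm]
        convert h2 using 3
        omega
      rw [h1, hc]; simp
  have h0 := key m le_rfl
  rw [Nat.sub_self] at h0
  rw [h0, ← pow_succ'] at hzero
  have hc : M.charpoly.coeff 0 = 0 := by
    apply htf m
    have := congrArg Matrix.trace hzero
    rw [trace_add, htr _ (by omega) le_rfl, trace_smul, trace_one, Fintype.card_fin,
      smul_eq_mul, zero_add, trace_zero] at this
    rw [mul_comm]; exact this
  rw [hc] at hzero
  simpa using hzero

/-- The square-zero extension trick. -/
theorem pow_eq_zero_of_central {A : Type*} [Ring A]
    (htf : ∀ (k : ℕ) (x : A), ((k + 1 : ℕ) : A) * x = 0 → x = 0)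
    {m : ℕ} (B : Matrix (Fin (m + 1)) (Fin (m + 1)) A)
    (hc : ∀ i j, (B ^ 2) i j ∈ Subring.center A)
    (htr : ∀ k, k ≤ m → (B ^ (2 * (k + 1))).trace = 0)
    (htr' : ∀ k, k ≤ m → (B ^ (2 * k + 1)).trace = 0) : B ^ (2 * m + 1) = 0 := by
  let Z := Subring.center A
  letI : Module Zᵐᵒᵖ A := Module.compHom _ ((RingHom.id Z).fromOpposite mul_comm)
  haveI : IsCentralScalar Z A := ⟨fun _ _ => rfl⟩
  have hop : ∀ (z : Z) (a : A), MulOpposite.op z • a = (z : A) * a := fun _ _ => rfl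
  have hsm : ∀ (z : Z) (a : A), z • a = (z : A) * a := fun _ _ => rfl
  let M : Matrix (Fin (m + 1)) (Fin (m + 1)) (TrivSqZeroExt Z A) :=
    Matrix.of fun i j => (TrivSqZeroExt.inl ⟨(B ^ 2) i j, hc i j⟩ + TrivSqZeroExt.inr (B i j))
  have hM1 : ∀ i j, ((M i j).fst : A) = (B ^ 2) i j := by intro i j; simp [M]
  have hM2 : ∀ i j, (M i j).snd = B i j := by intro i j; simp [M]
  have hfst : ∀ k i j, (((M ^ k) i j).fst : A) = (B ^ (2 * k)) i j := by
    intro k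
    induction k with
    | zero =>
      intro i j
      by_cases h : i = j
      · subst h; simp
      · simp [Matrix.one_apply_ne h]
    | succ k ih =>
      intro i j
      rw [pow_succ, Matrix.mul_apply, TrivSqZeroExt.fst_sum, mul_add, pow_add, Matrix.mul_apply]
      push_cast
      refine Finset.sum_congr rfl fun l _ => ?_
      rw [TrivSqZeroExt.fst_mul, ← hM1, ← ih]
      rfl
  have hsnd : ∀ k i j, ((M ^ (k + 1)) i j).snd = ((k + 1 : ℕ) : A) * (B ^ (2 * k + 1)) i j := by
    intro k
    induction k with
    | zero => intro i j; simp [hM2]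
    | succ k ih =>
      intro i j
      rw [pow_succ, Matrix.mul_apply, TrivSqZeroExt.snd_sum]
      simp only [TrivSqZeroExt.snd_mul, hop, hsm, hfst, ih, hM1, hM2]
      rw [Finset.sum_add_distrib, ← Matrix.mul_apply, ← pow_succ]
      have : ∀ l, (B ^ 2) l j * (((k + 1 : ℕ) : A) * (B ^ (2 * k + 1)) i l)
          = ((k + 1 : ℕ) : A) * ((B ^ (2 * k + 1)) i l * (B ^ 2) l j) := by
        intro l
        rw [← Subring.mem_center_iff.1 (hc l j), mul_assoc]
      rw [Finset.sum_congr rfl fun l _ => this l, ← Finset.mul_sum, ← Matrix.mul_apply, ← pow_add]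
      rw [show 2 * k + 1 + 2 = 2 * (k + 1) + 1 by ring, Nat.cast_succ (k + 1), add_mul, one_mul,
        add_comm]
  have hz : M ^ (m + 1) = 0 := by
    apply pow_eq_zero_of_trace
    · intro k x hx
      have e : ((k + 1 : ℕ) : TrivSqZeroExt Z A) * x = (k + 1) • x := by rw [nsmul_eq_mul]
      rw [e] at hx
      have h1 : x.fst = 0 := by
        have := congrArg (fun y => ((TrivSqZeroExt.fst y : Z) : A)) hx
        simp only [TrivSqZeroExt.fst_smul, TrivSqZeroExt.fst_zero] at this
        apply Subtype.ext
        apply htf k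
        rw [← nsmul_eq_mul]
        exact_mod_cast this
      have h2 : x.snd = 0 := by
        have := congrArg TrivSqZeroExt.snd hx
        rw [TrivSqZeroExt.snd_smul, nsmul_eq_mul] at this
        exact htf k _ this
      exact TrivSqZeroExt.ext h1 h2
    · intro k hk1 hk2
      obtain ⟨k, rfl⟩ : ∃ l, k = l + 1 := ⟨k - 1, by omega⟩
      apply TrivSqZeroExt.ext
      · apply Subtype.ext
        rw [Matrix.trace, TrivSqZeroExt.fst_sum]
        push_cast
        simp only [diag_apply, hfst]
        exact htr k (by omega)
      · rw [Matrix.trace, TrivSqZeroExt.snd_sum]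
        simp only [diag_apply, hsnd]
        rw [← Finset.mul_sum]
        have := htr' k (by omega)
        rw [Matrix.trace] at this
        simp only [diag_apply] at this
        rw [this]; simp
  ext i j
  apply htf m
  rw [← hsnd, hz]; rfl

section Ext

variable {K V : Type*} [Field K] [AddCommGroup V] [Module K V]

local notation "QQ" => (0 : QuadraticForm K V)

theorem iota_anticomm (a b : V) :
    CliffordAlgebra.ι QQ a * CliffordAlgebra.ι QQ b
      = -(CliffordAlgebra.ι QQ b * CliffordAlgebra.ι QQ a) :=
  eq_neg_of_add_eq_zero_left (ExteriorAlgebra.ι_add_mul_swap a b)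

theorem pair_comm (a b : V) (y : CliffordAlgebra QQ) :
    CliffordAlgebra.ι QQ a * CliffordAlgebra.ι QQ b * y
      = y * (CliffordAlgebra.ι QQ a * CliffordAlgebra.ι QQ b) := by
  induction y using CliffordAlgebra.induction with
  | algebraMap r => exact (Algebra.commutes r _).symm
  | ι v =>
    rw [mul_assoc, iota_anticomm b v, mul_neg, ← mul_assoc, iota_anticomm a v, neg_mul, neg_neg,
      mul_assoc]
  | mul x y hx hy => rw [← mul_assoc, hx, mul_assoc, hy, mul_assoc]
  | add x y hx hy => rw [mul_add, add_mul, hx, hy]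

theorem even_central (x : CliffordAlgebra QQ) (hx : x ∈ CliffordAlgebra.evenOdd QQ 0)
    (y : CliffordAlgebra QQ) : x * y = y * x := by
  induction x, hx using CliffordAlgebra.even_induction with
  | algebraMap r => exact Algebra.commutes r _
  | add x z _ _ hx hz => rw [mul_add, add_mul, hx, hz]
  | ι_mul_ι_mul a b x _ hx =>
    rw [mul_assoc, hx, ← mul_assoc, pair_comm, mul_assoc]

theorem iota_odd (v : V) (y : CliffordAlgebra QQ) (hy : y ∈ CliffordAlgebra.evenOdd QQ 1) :
    CliffordAlgebra.ι QQ v * y = -(y * CliffordAlgebra.ι QQ v) := by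
  induction y, hy using CliffordAlgebra.odd_induction with
  | ι w => exact iota_anticomm v w
  | add x z _ _ hx hz => rw [mul_add, add_mul, hx, hz, neg_add]
  | ι_mul_ι_mul a b x _ hx =>
    rw [← mul_assoc, ← pair_comm, mul_assoc, hx, mul_neg, mul_assoc _ x]

theorem odd_anticomm (x y : CliffordAlgebra QQ) (hx : x ∈ CliffordAlgebra.evenOdd QQ 1)
    (hy : y ∈ CliffordAlgebra.evenOdd QQ 1) : x * y = -(y * x) := by
  induction x, hx using CliffordAlgebra.odd_induction with
  | ι w => exact iota_odd w y hy
  | add x z _ _ hx hz => rw [mul_add, add_mul, hx, hz, neg_add]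
  | ι_mul_ι_mul a b x _ hx =>
    rw [mul_assoc, hx, mul_neg, ← mul_assoc, pair_comm, mul_assoc]

theorem pow_mem {n : ℕ} (B : Matrix (Fin n) (Fin n) (CliffordAlgebra QQ))
    (hB : ∀ i j, B i j ∈ CliffordAlgebra.evenOdd QQ 1) (k : ℕ) (i j : Fin n) :
    (B ^ k) i j ∈ CliffordAlgebra.evenOdd QQ (k : ZMod 2) := by
  induction k generalizing i j with
  | zero =>
    rw [pow_zero, Matrix.one_apply, Nat.cast_zero]
    split_ifs
    · exact SetLike.one_mem_graded _
    · exact Submodule.zero_mem _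
  | succ k ih =>
    rw [pow_succ, Matrix.mul_apply, Nat.cast_succ]
    exact Submodule.sum_mem _ fun l _ => SetLike.mul_mem_graded (ih i l) (hB l j)

end Ext

end GrassmannAux

/-- For `B ∈ Mₙ(E₁)` with `n ≥ 2`, if `tr(Bᵗ) = 0` for all `1 ≤ t ≤ 2n−1`, then
`B^{2n−1} = 0`. -/
theorem grassmann_odd_traceless_nilpotent
    {K : Type*} [Field K] [CharZero K] {n : ℕ} (hn : 2 ≤ n)
    (B : Matrix (Fin n) (Fin n) (ExteriorAlgebra K (ℕ →₀ K)))
    (hB : ∀ i j, B i j ∈ CliffordAlgebra.evenOdd (0 : QuadraticForm K (ℕ →₀ K)) 1)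
    (htr : ∀ t, 1 ≤ t → t ≤ 2 * n - 1 → (B ^ t).trace = 0) :
    B ^ (2 * n - 1) = 0 := by
  obtain ⟨m, rfl⟩ : ∃ m, n = m + 1 := ⟨n - 1, by omega⟩
  have htf : ∀ (k : ℕ) (x : ExteriorAlgebra K (ℕ →₀ K)),
      ((k + 1 : ℕ) : ExteriorAlgebra K (ℕ →₀ K)) * x = 0 → x = 0 := by
    intro k x hx
    have e : ((k + 1 : ℕ) : ExteriorAlgebra K (ℕ →₀ K)) * x = ((k + 1 : ℕ) : K) • x := by
      rw [Algebra.smul_def, map_natCast]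
    rw [e] at hx
    exact (smul_eq_zero.1 hx).resolve_left (Nat.cast_ne_zero.2 (Nat.succ_ne_zero k))
  rw [show 2 * (m + 1) - 1 = 2 * m + 1 by omega]
  apply GrassmannAux.pow_eq_zero_of_central htf
  · intro i j
    rw [Subring.mem_center_iff]
    intro g
    exact (GrassmannAux.even_central _ (GrassmannAux.pow_mem B hB 2 i j) g).symm
  · intro k hk
    have hodd : ∀ i j, (B ^ (2 * k + 1)) i j
        ∈ CliffordAlgebra.evenOdd (0 : QuadraticForm K (ℕ →₀ K)) 1 := by
      intro i j
      have := GrassmannAux.pow_mem B hB (2 * k + 1) i j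
      have e : ((2 * k + 1 : ℕ) : ZMod 2) = 1 := by
        push_cast
        rw [show (2 : ZMod 2) = 0 from rfl]; simp
      rwa [e] at this
    have h1 : (B ^ (2 * (k + 1))).trace = -(B ^ (2 * (k + 1))).trace := by
      conv_lhs => rw [show 2 * (k + 1) = 2 * k + 1 + 1 by ring, pow_succ]
      conv_rhs => rw [show 2 * (k + 1) = 2 * k + 1 + 1 by ring, pow_succ']
      simp only [Matrix.trace, diag_apply, Matrix.mul_apply]
      rw [Finset.sum_comm, ← Finset.sum_neg_distrib]
      refine Finset.sum_congr rfl fun i _ => ?_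
      rw [← Finset.sum_neg_distrib]
      refine Finset.sum_congr rfl fun j _ => ?_
      exact GrassmannAux.odd_anticomm _ _ (hodd _ _) (hB _ _)
    apply htf 1
    rw [← nsmul_eq_mul, two_nsmul]
    nth_rewrite 1 [h1]
    exact neg_add_cancel _
  · intro k hk
    exact htr _ (by omega) (by omega)
end

section
/- Let E = E₀ ⊕ E₁ be the infinite-dimensional Grassmann algebra over a field K of characteristic zero and B ∈ M₂(E₁) with tr(B) = 0, tr(B²) = 0 and tr(B³) = 0. Then B³ = 0. -/
open Matrix

theorem odd_anticomm {K : Type*} [Field K]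
    (x y : ExteriorAlgebra K (ℕ →₀ K))
    (hx : x ∈ CliffordAlgebra.evenOdd (0 : QuadraticForm K (ℕ →₀ K)) 1)
    (hy : y ∈ CliffordAlgebra.evenOdd (0 : QuadraticForm K (ℕ →₀ K)) 1) :
    x * y = -(y * x) := by
  have h := CliffordAlgebra.map_mul_map_eq_neg_of_isOrtho_of_mem_evenOdd_one
    (QuadraticMap.Isometry.id (0 : QuadraticForm K (ℕ →₀ K)))
    (QuadraticMap.Isometry.id (0 : QuadraticForm K (ℕ →₀ K)))
    (fun x y => by simp [QuadraticMap.IsOrtho]) x y hx hy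
  simpa [CliffordAlgebra.map_id] using h

theorem cube_entries {R : Type*} [Ring R] (B : Matrix (Fin 2) (Fin 2) R)
    (ha : B 0 0 * B 0 0 = 0) (hb : B 0 1 * B 0 1 = 0) (hc : B 1 0 * B 1 0 = 0)
    (hba : B 0 1 * B 0 0 = -(B 0 0 * B 0 1))
    (hca : B 1 0 * B 0 0 = -(B 0 0 * B 1 0))
    (hcb : B 1 0 * B 0 1 = -(B 0 1 * B 1 0))
    (hd : B 1 1 = - B 0 0) :
    (B ^ 3) 0 0 = 3 • (B 0 0 * (B 0 1 * B 1 0)) ∧ (B ^ 3) 0 1 = 0 ∧ (B ^ 3) 1 0 = 0 ∧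
    (B ^ 3) 1 1 = 3 • (B 0 0 * (B 0 1 * B 1 0)) := by
  simp only [pow_succ, pow_zero, one_mul, Matrix.mul_apply, Fin.sum_univ_two, hd]
  generalize B 0 0 = a at *
  generalize B 0 1 = b at *
  generalize B 1 0 = c at *
  have ha' : ∀ x, a * (a * x) = 0 := fun x => by rw [← mul_assoc, ha, zero_mul]
  have hb' : ∀ x, b * (b * x) = 0 := fun x => by rw [← mul_assoc, hb, zero_mul]
  have hba' : ∀ x, b * (a * x) = -(a * (b * x)) := fun x => by
    rw [← mul_assoc, hba, neg_mul, mul_assoc]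
  have hca' : ∀ x, c * (a * x) = -(a * (c * x)) := fun x => by
    rw [← mul_assoc, hca, neg_mul, mul_assoc]
  have hcb' : ∀ x, c * (b * x) = -(b * (c * x)) := fun x => by
    rw [← mul_assoc, hcb, neg_mul, mul_assoc]
  refine ⟨?_, ?_, ?_, ?_⟩ <;>
  simp only [add_mul, mul_assoc, neg_mul, mul_neg, ha, hb, hc, hba, hca, hcb, ha', hb', hba', hca',
    hcb', mul_zero, neg_zero, neg_neg, add_zero, zero_add] <;> abel

/-- If `B ∈ M₂(E₁)` satisfies `tr(B) = tr(B²) = tr(B³) = 0`, then `B³ = 0`. -/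
theorem grassmann_odd_B3_zero
    {K : Type*} [Field K] [CharZero K]
    (B : Matrix (Fin 2) (Fin 2) (ExteriorAlgebra K (ℕ →₀ K)))
    (hB : ∀ i j, B i j ∈ CliffordAlgebra.evenOdd (0 : QuadraticForm K (ℕ →₀ K)) 1)
    (h1 : B.trace = 0) (h2 : (B ^ 2).trace = 0) (h3 : (B ^ 3).trace = 0) :
    B ^ 3 = 0 := by
  have tf : ∀ (n : K) (x : ExteriorAlgebra K (ℕ →₀ K)), n ≠ 0 → n • x = 0 → x = 0 :=
    fun n x hn h => (smul_eq_zero.mp h).resolve_left hn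
  have sq : ∀ i j, B i j * B i j = 0 := fun i j => by
    have h := odd_anticomm _ _ (hB i j) (hB i j)
    apply tf 2 _ two_ne_zero
    rw [two_smul]
    exact eq_neg_iff_add_eq_zero.mp h
  have ha := sq 0 0
  have hb := sq 0 1
  have hc := sq 1 0
  have hba := odd_anticomm _ _ (hB 0 1) (hB 0 0)
  have hca := odd_anticomm _ _ (hB 1 0) (hB 0 0)
  have hcb := odd_anticomm _ _ (hB 1 0) (hB 0 1)
  have hd : B 1 1 = - B 0 0 := by
    rw [Matrix.trace_fin_two] at h1
    exact eq_neg_of_add_eq_zero_right h1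
  obtain ⟨e00, e01, e10, e11⟩ := cube_entries B ha hb hc hba hca hcb hd
  have habc : B 0 0 * (B 0 1 * B 1 0) = 0 := by
    rw [Matrix.trace_fin_two, e00, e11, ← add_smul] at h3
    apply tf 6 _ (by norm_num)
    rw [← h3, ← Nat.cast_smul_eq_nsmul K]
    norm_num
  ext i j
  fin_cases i <;> fin_cases j <;> simp [e00, e01, e10, e11, habc]
end
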